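/- arXiv:1008.1553 — 4 statements merged into one kernel-verified Lean document; each statement's English description precedes it below -/
import Mathlib

section
/- For any finite family (Ē_i)_{i=1,…,n} of nonzero euclidean lattices, one has μ_max(Ē_1 ⊗ ⋯ ⊗ Ē_n) ≤ Σ_{i=1}^n ( μ_max(Ē_i) + (1/2)·log rk(Ē_i) ). -/
noncomputable section

/-- The covolume of a euclidean lattice presented by the Gram matrix `B` of a `ℤ`-basis:
the square root of the Gram determinant. -/
def latVol {ι : Type} [Fintype ι] [DecidableEq ι] (B : Matrix ι ι ℝ) : ℝ :=
  Real.sqrt B.det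

/-- The arithmetic degree of a euclidean lattice: `- log` of its covolume. -/
def latDeg {ι : Type} [Fintype ι] [DecidableEq ι] (B : Matrix ι ι ℝ) : ℝ :=
  - Real.log (latVol B)

/-- The slope of a euclidean lattice: degree divided by rank. -/
def latMu {ι : Type} [Fintype ι] [DecidableEq ι] (B : Matrix ι ι ℝ) : ℝ :=
  latDeg B / (Fintype.card ι)

/-- The Gram matrix (for the induced inner product) of the rank-`s` sublattice whose
`ℤ`-basis consists of the columns of the integer matrix `A`, inside the lattice with
Gram matrix `B`. -/
def inducedGram {ι : Type} [Fintype ι] (B : Matrix ι ι ℝ) {s : ℕ}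
    (A : Matrix ι (Fin s) ℤ) : Matrix (Fin s) (Fin s) ℝ :=
  (A.map (Int.cast : ℤ → ℝ)).transpose * B * A.map (Int.cast : ℤ → ℝ)

/-- The maximal slope `μ_max` of a euclidean lattice: the supremum of the slopes of its
nonzero sublattices (of any rank), each equipped with the induced inner product.  A nonzero
sublattice is presented by a `ℤ`-basis, i.e. by the columns of an integer matrix `A` which
are linearly independent over `ℤ`. -/
def latMuMax {ι : Type} [Fintype ι] [DecidableEq ι] (B : Matrix ι ι ℝ) : ℝ :=
  sSup { m : ℝ | ∃ (s : ℕ) (A : Matrix ι (Fin s) ℤ), 0 < s ∧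
    LinearIndependent ℤ (fun k : Fin s => fun i : ι => A i k) ∧
    m = latMu (inducedGram B A) }

end

open scoped Matrix Kronecker

/-- The squared first minimum of the euclidean lattice with Gram matrix `B` is at least `m`. -/
def SqMinGE {ι : Type} [Fintype ι] (B : Matrix ι ι ℝ) (m : ℝ) : Prop :=
  ∀ x : ι → ℤ, x ≠ 0 →
    m ≤ (fun i => (x i : ℝ)) ⬝ᵥ B *ᵥ (fun i => (x i : ℝ))

lemma Matrix.PosDef.exists_transpose_mul_self {ι : Type} [Fintype ι] [DecidableEq ι]
    {B : Matrix ι ι ℝ} (hB : B.PosDef) :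
    ∃ A : Matrix ι ι ℝ, A.det ≠ 0 ∧ B = Aᵀ * A := by
  open scoped MatrixOrder in
  obtain ⟨A, hA⟩ := CStarAlgebra.nonneg_iff_eq_star_mul_self.mp hB.posSemidef.nonneg
  have hA' : B = Aᵀ * A := by
    rw [hA, Matrix.star_eq_conjTranspose, Matrix.conjTranspose_eq_transpose_of_trivial]
  refine ⟨A, fun h => hB.det_pos.ne' ?_, hA'⟩
  rw [hA', Matrix.det_mul, h, mul_zero]

lemma Matrix.dotProduct_transpose_mul_self_mulVec {R ι κ : Type*} [CommRing R] [Fintype ι]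
    [Fintype κ] (A : Matrix ι κ R) (v : κ → R) :
    v ⬝ᵥ (Aᵀ * A) *ᵥ v = ∑ i, (A *ᵥ v) i ^ 2 := by
  rw [← Matrix.mulVec_mulVec, Matrix.dotProduct_mulVec, Matrix.vecMul_transpose]
  simp [dotProduct, sq]

lemma Matrix.PosDef.exists_sqMinGE {ι : Type} [Fintype ι] [DecidableEq ι]
    {B : Matrix ι ι ℝ} (hB : B.PosDef) :
    ∃ m, 0 < m ∧ SqMinGE B m := by
  obtain ⟨A, hA, rfl⟩ := hB.exists_transpose_mul_self
  set S : ℝ := ∑ i, ∑ j, (A⁻¹ i j) ^ 2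
  have hS0 : 0 ≤ S := by positivity
  refine ⟨1 / (1 + S), by positivity, fun x hx => ?_⟩
  rw [Matrix.dotProduct_transpose_mul_self_mulVec]
  set v : ι → ℝ := fun i => (x i : ℝ) with hv
  obtain ⟨i, hi⟩ := Function.ne_iff.mp hx
  have hinv : A⁻¹ *ᵥ (A *ᵥ v) = v := by
    rw [Matrix.mulVec_mulVec, Matrix.nonsing_inv_mul _ (isUnit_iff_ne_zero.mpr hA),
      Matrix.one_mulVec]
  have h1 : (1 : ℝ) ≤ v i ^ 2 := by
    have : (1 : ℤ) ≤ x i ^ 2 := one_le_sq_iff_one_le_abs _ |>.mpr (Int.one_le_abs hi)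
    simpa [hv] using (by exact_mod_cast this : (1 : ℝ) ≤ (x i : ℝ) ^ 2)
  have h2 : v i ^ 2 ≤ (∑ j, (A⁻¹ i j) ^ 2) * ∑ j, (A *ᵥ v) j ^ 2 := by
    conv_lhs => rw [← hinv]
    exact Finset.sum_mul_sq_le_sq_mul_sq _ _ _
  have h3 : ∑ j, (A⁻¹ i j) ^ 2 ≤ S :=
    Finset.single_le_sum (f := fun i => ∑ j, (A⁻¹ i j) ^ 2)
      (fun _ _ => by positivity) (Finset.mem_univ i)
  have h4 : 0 ≤ ∑ j, (A *ᵥ v) j ^ 2 := by positivity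
  rw [div_le_iff₀ (by positivity)]
  nlinarith [mul_le_mul_of_nonneg_right h3 h4]

/-- Minkowski's first theorem, with the Hermite constant bounded by the rank. -/
lemma SqMinGE.pow_le_det {s : ℕ} (hs : 0 < s) {H : Matrix (Fin s) (Fin s) ℝ} (hH : H.PosDef)
    {m : ℝ} (hm : 0 < m) (h : SqMinGE H m) : (m / s) ^ s ≤ H.det := by
  obtain ⟨A, hA, rfl⟩ := hH.exists_transpose_mul_self
  by_contra! hlt
  have hs' : (0 : ℝ) < s := by exact_mod_cast hs
  set u : ℝ := √(m / s) with hu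
  have hu0 : 0 < u := Real.sqrt_pos.mpr (by positivity)
  have hu2 : u ^ 2 = m / s := Real.sq_sqrt (by positivity)
  rw [Matrix.det_mul, Matrix.det_transpose, ← hu2, ← pow_mul, mul_comm 2 s, pow_mul, ← sq] at hlt
  have hd : |A.det| < u ^ s := abs_lt_of_sq_lt_sq hlt (by positivity)
  have hd0 : 0 < |A.det| := abs_pos.mpr hA
  let b := Pi.basisFun ℝ (Fin s)
  let S : Set (Fin s → ℝ) := Matrix.toLin' A ⁻¹' (Set.pi Set.univ fun _ => Set.Ioo (-u) u)
  have hvol : MeasureTheory.volume S = ENNReal.ofReal (|A.det|⁻¹ * (2 * u) ^ s) := by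
    rw [MeasureTheory.Measure.addHaar_preimage_linearMap _ (by simpa using hA), Real.volume_pi_Ioo,
      LinearMap.det_toLin', Finset.prod_const, ← ENNReal.ofReal_pow (by linarith),
      ← ENNReal.ofReal_mul (by positivity), abs_inv, Finset.card_univ, Fintype.card_fin]
    congr 3
    ring
  have hfund : MeasureTheory.volume (ZSpan.fundamentalDomain b) = 1 := by
    rw [ZSpan.fundamentalDomain_pi_basisFun, Real.volume_pi_Ico]
    simp
  have : Countable (Submodule.span ℤ (Set.range b)).toAddSubgroup :=
    inferInstanceAs (Countable (Submodule.span ℤ (Set.range b)))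
  obtain ⟨⟨x, hxL⟩, hx0, hxS⟩ :=
    MeasureTheory.exists_ne_zero_mem_lattice_of_measure_mul_two_pow_lt_measure
      (s := S) (ZSpan.isAddFundamentalDomain' b MeasureTheory.volume)
      (fun x hx i _ => by
        have := hx i trivial
        simp only [map_neg, Pi.neg_apply, Set.mem_Ioo] at this ⊢
        exact ⟨by linarith, by linarith⟩)
      ((convex_pi fun _ _ => convex_Ioo _ _).linear_preimage _)
      (by
        rw [hfund, hvol, one_mul, Module.finrank_fin_fun, ← ENNReal.ofReal_ofNat,
          ← ENNReal.ofReal_pow (by norm_num), ENNReal.ofReal_lt_ofReal_iff (by positivity), mul_pow,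
          lt_inv_mul_iff₀ hd0]
        nlinarith [pow_pos (two_pos : (0 : ℝ) < 2) s])
  have hz := (b.mem_span_iff_repr_mem ℤ x).mp hxL
  choose z hz using hz
  have hzx : (fun i => (z i : ℝ)) = x := by
    ext i
    simpa [b] using hz i
  have hz0 : z ≠ 0 := by
    rintro rfl
    apply hx0
    ext i
    simp [← hzx]
  have hq := h z hz0
  rw [hzx, Matrix.dotProduct_transpose_mul_self_mulVec] at hq
  have : ∑ i, (A *ᵥ x) i ^ 2 < ∑ _i : Fin s, u ^ 2 := by
    apply Finset.sum_lt_sum_of_nonempty ⟨⟨0, hs⟩, Finset.mem_univ _⟩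
    intro i _
    have := hxS i trivial
    rw [Matrix.toLin'_apply] at this
    exact sq_lt_sq' this.1 this.2
  rw [Finset.sum_const, Finset.card_univ, Fintype.card_fin, hu2, nsmul_eq_mul,
    mul_div_cancel₀ _ hs'.ne'] at this
  linarith

lemma Matrix.PosSemidef.det_le_trace_div_pow {s : ℕ} (hs : 0 < s) {P : Matrix (Fin s) (Fin s) ℝ}
    (hP : P.PosSemidef) : P.det ≤ (P.trace / s) ^ s := by
  have hs' : (0 : ℝ) < s := by exact_mod_cast hs
  rw [hP.1.det_eq_prod_eigenvalues, hP.1.trace_eq_sum_eigenvalues]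
  have h0 := fun i => hP.eigenvalues_nonneg i
  have := Real.geom_mean_le_arith_mean Finset.univ (fun _ => (1 : ℝ)) hP.1.eigenvalues
    (fun _ _ => zero_le_one) (by simpa using hs) (fun i _ => h0 i)
  simp only [Real.rpow_one, Finset.sum_const, Finset.card_univ, Fintype.card_fin, nsmul_eq_mul,
    mul_one, one_mul] at this
  have hprod : 0 ≤ ∏ i, hP.1.eigenvalues i := Finset.prod_nonneg fun i _ => h0 i
  have h2 := pow_le_pow_left₀ (by positivity) this s
  rwa [Real.rpow_inv_natCast_pow hprod hs.ne'] at h2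

lemma Matrix.PosDef.det_mul_det_le {s : ℕ} (hs : 0 < s) {G H : Matrix (Fin s) (Fin s) ℝ}
    (hG : G.PosDef) (hH : H.PosDef) : G.det * H.det ≤ ((G * H).trace / s) ^ s := by
  obtain ⟨A, -, rfl⟩ := hG.exists_transpose_mul_self
  have hP : (A * H * Aᵀ).PosSemidef := by
    simpa using hH.posSemidef.mul_mul_conjTranspose_same A
  have := hP.det_le_trace_div_pow hs
  rw [Matrix.trace_mul_comm, ← Matrix.mul_assoc] at this
  refine le_trans (le_of_eq ?_) this
  simp only [Matrix.det_mul, Matrix.det_transpose]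
  ring

lemma Matrix.mulVec_eq_zero_of_linearIndependent {ι : Type} [Fintype ι] {s : ℕ}
    {A : Matrix ι (Fin s) ℤ} (hA : LinearIndependent ℤ (fun k : Fin s => fun i : ι => A i k))
    {c : Fin s → ℤ} (hc : A *ᵥ c = 0) : c = 0 :=
  Matrix.mulVec_injective_iff.mpr hA (by rw [hc, Matrix.mulVec_zero])

/-- Integer vectors linearly independent over `ℤ` are linearly independent over `ℝ`: their
integral Gram matrix has nonzero determinant. -/
lemma Matrix.mulVec_map_intCast_injective {ι : Type} [Fintype ι] {s : ℕ}
    {A : Matrix ι (Fin s) ℤ} (hA : LinearIndependent ℤ (fun k : Fin s => fun i : ι => A i k)) :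
    Function.Injective (A.map (Int.cast : ℤ → ℝ)).mulVec := by
  have hdet : (Aᵀ * A).det ≠ 0 := by
    intro h
    obtain ⟨c, hc0, hc⟩ := Matrix.exists_mulVec_eq_zero_iff.mpr h
    apply hc0
    apply Matrix.mulVec_eq_zero_of_linearIndependent hA
    have := Matrix.dotProduct_transpose_mul_self_mulVec A c
    rw [hc, dotProduct_zero, eq_comm, Finset.sum_eq_zero_iff_of_nonneg (fun _ _ => sq_nonneg _)]
      at this
    ext i
    simpa using this i (Finset.mem_univ i)
  have hdet' : ((A.map (Int.cast : ℤ → ℝ))ᵀ * A.map (Int.cast : ℤ → ℝ)).det ≠ 0 := by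
    have hmap : (A.map (Int.cast : ℤ → ℝ))ᵀ * A.map (Int.cast : ℤ → ℝ) =
        (Int.castRingHom ℝ).mapMatrix (Aᵀ * A) := by
      ext i j
      simp [Matrix.mul_apply]
    rw [hmap, ← RingHom.map_det]
    simpa using hdet
  intro c d hcd
  have := congrArg (fun v => (A.map (Int.cast : ℤ → ℝ))ᵀ *ᵥ v) hcd
  simp only [Matrix.mulVec_mulVec] at this
  exact Matrix.mulVec_injective_of_isUnit
    ((Matrix.isUnit_iff_isUnit_det _).mpr (isUnit_iff_ne_zero.mpr hdet')) this

lemma inducedGram_posDef {ι : Type} [Fintype ι] {B : Matrix ι ι ℝ} (hB : B.PosDef) {s : ℕ}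
    {A : Matrix ι (Fin s) ℤ} (hA : LinearIndependent ℤ (fun k : Fin s => fun i : ι => A i k)) :
    (inducedGram B A).PosDef := by
  simpa [inducedGram] using
    hB.conjTranspose_mul_mul_same (Matrix.mulVec_map_intCast_injective hA)

lemma SqMinGE.inducedGram_of_linearIndependent {ι : Type} [Fintype ι] {B : Matrix ι ι ℝ} {m : ℝ} (h : SqMinGE B m)
    {s : ℕ} {A : Matrix ι (Fin s) ℤ}
    (hA : LinearIndependent ℤ (fun k : Fin s => fun i : ι => A i k)) :
    SqMinGE (inducedGram B A) m := by
  intro c hc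
  have hAc : A *ᵥ c ≠ 0 := fun h0 => hc (Matrix.mulVec_eq_zero_of_linearIndependent hA h0)
  have hcast : (fun i => ((A *ᵥ c) i : ℝ)) =
      A.map (Int.cast : ℤ → ℝ) *ᵥ fun i => (c i : ℝ) := by
    ext i
    simp [Matrix.mulVec, dotProduct]
  have := h _ hAc
  rw [hcast] at this
  rw [inducedGram, Matrix.mul_assoc, ← Matrix.mulVec_mulVec, Matrix.dotProduct_mulVec,
    Matrix.vecMul_transpose, ← Matrix.mulVec_mulVec]
  exact this

lemma latMu_eq_log_det {s : ℕ} {H : Matrix (Fin s) (Fin s) ℝ} (hH : H.PosDef) :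
    latMu H = -(Real.log H.det / 2) / s := by
  rw [latMu, latDeg, latVol, Real.log_sqrt hH.det_pos.le, Fintype.card_fin]

lemma latMu_le_of_pow_le_det {s : ℕ} (hs : 0 < s) {H : Matrix (Fin s) (Fin s) ℝ} (hH : H.PosDef)
    {m : ℝ} (hm : 0 < m) (h : m ^ s ≤ H.det) : latMu H ≤ -(Real.log m / 2) := by
  have hs' : (0 : ℝ) < s := by exact_mod_cast hs
  have := Real.log_le_log (by positivity) h
  rw [Real.log_pow] at this
  rw [latMu_eq_log_det hH, div_le_iff₀ hs']
  linarith

lemma exp_pow_le_det_of_latMu_le {s : ℕ} (hs : 0 < s) {H : Matrix (Fin s) (Fin s) ℝ}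
    (hH : H.PosDef) {c : ℝ} (h : latMu H ≤ c) : Real.exp (-2 * c) ^ s ≤ H.det := by
  have hs' : (0 : ℝ) < s := by exact_mod_cast hs
  rw [latMu_eq_log_det hH, div_le_iff₀ hs'] at h
  rw [← Real.exp_nat_mul, ← Real.le_log_iff_exp_le hH.det_pos]
  linarith

lemma SqMinGE.latMu_inducedGram_le {ι : Type} [Fintype ι] {B : Matrix ι ι ℝ} (hB : B.PosDef)
    {m : ℝ} (hm : 0 < m) (h : SqMinGE B m) {s : ℕ} (hs : 0 < s) {A : Matrix ι (Fin s) ℤ}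
    (hA : LinearIndependent ℤ (fun k : Fin s => fun i : ι => A i k)) :
    latMu (inducedGram B A) ≤
      -(Real.log m / 2) + 1 / 2 * Real.log (Fintype.card ι) := by
  have hs' : (0 : ℝ) < s := by exact_mod_cast hs
  have hG := inducedGram_posDef hB hA
  have hle := latMu_le_of_pow_le_det hs hG (by positivity)
    ((h.inducedGram_of_linearIndependent hA).pow_le_det hs hG hm)
  rw [Real.log_div hm.ne' hs'.ne'] at hle
  have hcard : s ≤ Fintype.card ι := by
    simpa using hA.fintype_card_le_finrank
  have := Real.log_le_log hs' (by exact_mod_cast hcard : (s : ℝ) ≤ Fintype.card ι)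
  linarith

lemma latMu_inducedGram_le_latMuMax {ι : Type} [Fintype ι] [DecidableEq ι] {B : Matrix ι ι ℝ}
    (hB : B.PosDef) {s : ℕ} (hs : 0 < s) {A : Matrix ι (Fin s) ℤ}
    (hA : LinearIndependent ℤ (fun k : Fin s => fun i : ι => A i k)) :
    latMu (inducedGram B A) ≤ latMuMax B := by
  obtain ⟨m, hm, hmin⟩ := hB.exists_sqMinGE
  refine le_csSup ⟨-(Real.log m / 2) + 1 / 2 * Real.log (Fintype.card ι), ?_⟩ ⟨s, A, hs, hA, rfl⟩
  rintro _ ⟨t, A', ht, hA', rfl⟩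
  exact hmin.latMu_inducedGram_le hB hm ht hA'

lemma SqMinGE.latMuMax_le {ι : Type} [Fintype ι] [DecidableEq ι] [Nonempty ι] {B : Matrix ι ι ℝ}
    (hB : B.PosDef) {m : ℝ} (hm : 0 < m) (h : SqMinGE B m) :
    latMuMax B ≤ -(Real.log m / 2) + 1 / 2 * Real.log (Fintype.card ι) := by
  apply csSup_le
  · refine ⟨_, 1, fun _ _ => 1, one_pos, ?_, rfl⟩
    rw [linearIndependent_unique_iff]
    exact fun h0 => one_ne_zero (congrFun h0 (Classical.arbitrary ι))
  · rintro _ ⟨s, A, hs, hA, rfl⟩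
    exact h.latMu_inducedGram_le hB hm hs hA

/-- Every integer matrix is the product of a matrix with independent columns and a matrix with
independent rows. -/
lemma Matrix.exists_mul_eq_of_ne_zero {ι κ : Type} [Finite ι] [Finite κ] {V : Matrix ι κ ℤ}
    (hV : V ≠ 0) :
    ∃ (s : ℕ) (F : Matrix ι (Fin s) ℤ) (W : Matrix (Fin s) κ ℤ), 0 < s ∧ V = F * W ∧
      LinearIndependent ℤ (fun k : Fin s => fun i : ι => F i k) ∧
      LinearIndependent ℤ (fun k : Fin s => fun j : κ => W k j) := by
  cases nonempty_fintype ι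
  set L : Submodule ℤ (κ → ℤ) := Submodule.span ℤ (Set.range V) with hL
  have hrow : ∀ i, V i ∈ L := fun i => Submodule.subset_span ⟨i, rfl⟩
  let b := Module.finBasis ℤ L
  set s := Module.finrank ℤ L
  let F : Matrix ι (Fin s) ℤ := fun i k => b.repr ⟨V i, hrow i⟩ k
  let W : Matrix (Fin s) κ ℤ := fun k => (b k : κ → ℤ)
  have hFW : V = F * W := by
    ext i j
    have := congrArg (fun v : L => (v : κ → ℤ) j) (b.sum_repr ⟨V i, hrow i⟩)
    simp only [Submodule.coe_sum, Submodule.coe_smul, Finset.sum_apply, Pi.smul_apply,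
      smul_eq_mul] at this
    rw [Matrix.mul_apply, ← this]
  have hW : LinearIndependent ℤ (fun k : Fin s => fun j : κ => W k j) :=
    b.linearIndependent.map' L.subtype (Submodule.ker_subtype L)
  refine ⟨s, F, W, ?_, hFW, ?_, hW⟩
  · rw [Nat.pos_iff_ne_zero]
    intro h0
    apply hV
    rw [hFW]
    ext i j
    rw [Matrix.mul_apply]
    exact Finset.sum_eq_zero fun k _ => absurd k.2 (by omega)
  · rw [Fintype.linearIndependent_iff]
    intro c hc
    let φ : L →ₗ[ℤ] ℤ := b.constr ℤ c
    have hφ : ∀ v : L, φ v = ∑ k, b.repr v k * c k := fun v => by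
      simp [φ, Module.Basis.constr_apply_fintype]
    have hzero : φ = 0 := by
      apply LinearMap.ext
      rintro ⟨v, hv⟩
      induction hv using Submodule.span_induction with
      | mem x hx =>
        obtain ⟨i, rfl⟩ := hx
        rw [hφ]
        have := congrFun hc i
        simpa [F, mul_comm] using this
      | zero => exact map_zero φ
      | add x y hx hy hx' hy' =>
        have := map_add φ ⟨x, hx⟩ ⟨y, hy⟩
        rw [hx', hy'] at this
        simpa using this
      | smul a x hx hx' =>
        have := map_smul φ a ⟨x, hx⟩
        rw [hx'] at this
        simpa using this
    intro k
    have := congrArg (fun f : L →ₗ[ℤ] ℤ => f (b k)) hzero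
    simpa [φ] using this

/-- Tensoring with `Ē` decreases the first minimum at most by the factor `exp (-μ_max(Ē))`. -/
lemma SqMinGE.kronecker {ι κ : Type} [Fintype ι] [DecidableEq ι] [Fintype κ]
    {B : Matrix ι ι ℝ} (hB : B.PosDef) {C : Matrix κ κ ℝ} (hC : C.PosDef) {m : ℝ} (hm : 0 < m)
    (h : SqMinGE C m) : SqMinGE (B ⊗ₖ C) (Real.exp (-2 * latMuMax B) * m) := by
  intro x hx
  let V : Matrix ι κ ℤ := fun i j => x (i, j)
  have hV : V ≠ 0 := by
    intro h0
    exact hx (funext fun p => congrFun (congrFun h0 p.1) p.2)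
  obtain ⟨s, F, W, hs, hFW, hF, hW⟩ := Matrix.exists_mul_eq_of_ne_zero hV
  have hs' : (0 : ℝ) < s := by exact_mod_cast hs
  replace hW : LinearIndependent ℤ (fun k : Fin s => fun j : κ => Wᵀ j k) := hW
  have hG := inducedGram_posDef hB hF
  have hH := inducedGram_posDef hC hW
  have hq : (fun p => (x p : ℝ)) ⬝ᵥ (B ⊗ₖ C) *ᵥ (fun p => (x p : ℝ)) =
      (inducedGram B F * inducedGram C Wᵀ).trace := by
    have hVF : V.map (Int.cast : ℤ → ℝ) = F.map (Int.cast : ℤ → ℝ) * W.map (Int.cast : ℤ → ℝ) := by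
      rw [hFW]
      exact Matrix.map_mul (f := Int.castRingHom ℝ)
    have hBt : Bᵀ = B := by simpa using hB.isHermitian.eq
    calc
      _ = (V.map (Int.cast : ℤ → ℝ))ᵀ.vec ⬝ᵥ (B ⊗ₖ C) *ᵥ (V.map (Int.cast : ℤ → ℝ))ᵀ.vec := rfl
      _ = _ := by
        rw [Matrix.kronecker_mulVec_vec, Matrix.vec_dotProduct_vec, hVF, hBt, inducedGram,
          inducedGram, Matrix.transpose_map, Matrix.transpose_transpose,
          Matrix.transpose_transpose, Matrix.transpose_mul]
        simpa only [Matrix.mul_assoc] using Matrix.trace_mul_comm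
          (F.map (Int.cast : ℤ → ℝ) * W.map (Int.cast : ℤ → ℝ) * C *
            (W.map (Int.cast : ℤ → ℝ))ᵀ)
          ((F.map (Int.cast : ℤ → ℝ))ᵀ * B)
  have h1 := exp_pow_le_det_of_latMu_le hs hG (latMu_inducedGram_le_latMuMax hB hs hF)
  have h2 := (h.inducedGram_of_linearIndependent hW).pow_le_det hs hH hm
  have h3 := hG.det_mul_det_le hs hH
  rw [hq]
  have hPG : 0 ≤ (inducedGram B F * inducedGram C Wᵀ).trace := by
    rw [← hq]
    simpa using (hB.kronecker hC).posSemidef.dotProduct_mulVec_nonneg (fun p => (x p : ℝ))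
  have h4 : (Real.exp (-2 * latMuMax B) * (m / s)) ^ s ≤
      ((inducedGram B F * inducedGram C Wᵀ).trace / s) ^ s := by
    rw [mul_pow]
    exact (mul_le_mul h1 h2 (by positivity) hG.det_pos.le).trans h3
  have h5 := le_of_pow_le_pow_left₀ hs.ne' (by positivity) h4
  rwa [← mul_div_assoc, div_le_div_iff_of_pos_right hs'] at h5

/-- Gram matrix of the tensor product of a finite family of lattices. -/
def tensorGram {n : ℕ} {r : Fin n → ℕ} (B : ∀ i, Matrix (Fin (r i)) (Fin (r i)) ℝ) :
    Matrix (∀ i, Fin (r i)) (∀ i, Fin (r i)) ℝ :=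
  Matrix.of fun x y => ∏ i, B i (x i) (y i)

lemma tensorGram_succ {n : ℕ} {r : Fin (n + 1) → ℕ}
    (B : ∀ i, Matrix (Fin (r i)) (Fin (r i)) ℝ) :
    tensorGram B = (B 0 ⊗ₖ tensorGram fun i : Fin n => B i.succ).submatrix
      (Fin.consEquiv fun i => Fin (r i)).symm (Fin.consEquiv fun i => Fin (r i)).symm := by
  ext x y
  simp [tensorGram, Fin.prod_univ_succ, Fin.consEquiv, Fin.tail]

lemma SqMinGE.submatrix_equiv {ι κ : Type} [Fintype ι] [Fintype κ] {B : Matrix ι ι ℝ} {m : ℝ}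
    (h : SqMinGE B m) (e : κ ≃ ι) : SqMinGE (B.submatrix e e) m := by
  intro x hx
  have := h (x ∘ e.symm) fun h0 => hx (by
    ext k
    simpa using congrFun h0 (e k))
  rw [Matrix.submatrix_mulVec_equiv, ← comp_equiv_symm_dotProduct]
  exact this

lemma tensorGram_posDef_and_sqMinGE {n : ℕ} {r : Fin n → ℕ}
    (B : ∀ i, Matrix (Fin (r i)) (Fin (r i)) ℝ) (hB : ∀ i, (B i).PosDef) :
    (tensorGram B).PosDef ∧ SqMinGE (tensorGram B) (Real.exp (-2 * ∑ i, latMuMax (B i))) := by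
  induction n with
  | zero =>
    have h1 : tensorGram B = 1 := by
      ext x y
      simp [tensorGram, Subsingleton.elim x y, Matrix.one_apply]
    rw [h1]
    refine ⟨Matrix.PosDef.one, fun x hx => ?_⟩
    obtain ⟨i, hi⟩ := Function.ne_iff.mp hx
    have : (1 : ℤ) ≤ x i ^ 2 := one_le_sq_iff_one_le_abs _ |>.mpr (Int.one_le_abs hi)
    rw [Subsingleton.elim i default] at this
    simpa [dotProduct, sq] using (by exact_mod_cast this : (1 : ℝ) ≤ (x default : ℝ) ^ 2)
  | succ n ih =>
    obtain ⟨hP, hM⟩ := ih (fun i => B i.succ) fun i => hB i.succ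
    rw [tensorGram_succ]
    refine ⟨((hB 0).kronecker hP).submatrix (Equiv.injective _), ?_⟩
    have := (hM.kronecker (hB 0) hP (Real.exp_pos _)).submatrix_equiv
      (Fin.consEquiv fun i => Fin (r i)).symm
    rwa [← Real.exp_add, ← mul_add, ← Fin.sum_univ_succ (fun i => latMuMax (B i))] at this

/-- For any finite family of nonzero euclidean lattices `Ē i` (presented by
positive definite Gram matrices `B i` of rank `r i ≥ 1`), the maximal slope of their tensor
product (whose Gram matrix, in the tensor product basis, has entries
`∏ i, B i (x i) (y i)`) satisfies
`μ_max(⊗ Ē_i) ≤ ∑ i (μ_max(Ē_i) + (1/2) log rk Ē_i)`. -/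
theorem latMuMax_tensor_le (n : ℕ) (r : Fin n → ℕ) (hr : ∀ i, 0 < r i)
    (B : ∀ i, Matrix (Fin (r i)) (Fin (r i)) ℝ) (hB : ∀ i, (B i).PosDef) :
    latMuMax (Matrix.of fun x y : (∀ i, Fin (r i)) => ∏ i, B i (x i) (y i)) ≤
      ∑ i, (latMuMax (B i) + (1 / 2) * Real.log (r i)) := by
  obtain ⟨hP, hM⟩ := tensorGram_posDef_and_sqMinGE B hB
  have : ∀ i, Nonempty (Fin (r i)) := fun i => ⟨⟨0, hr i⟩⟩
  refine (hM.latMuMax_le hP (Real.exp_pos _)).trans (le_of_eq ?_)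
  rw [Real.log_exp, Fintype.card_pi, Nat.cast_prod,
    Real.log_prod fun i _ => by simpa using (hr i).ne', Finset.sum_add_distrib, ← Finset.mul_sum]
  simp only [Fintype.card_fin]
  ring
end

section
/- Let 𝔸₂ be the euclidean lattice of rank 2 with Gram matrix [[2,1],[1,2]] in a basis (e₁,e₂), and fix λ ∈ [ (1/2)·log(3/2), (1/4)·log 3 ). Then the rescaled lattice 𝔸₂⟨λ⟩ is nef, and its degree deg(𝔸₂⟨λ⟩) = 2λ − (1/2)·log 3 is negative. In particular, a nef hermitian lattice may have negative degree. -/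
open scoped NumberField ComplexOrder Classical

noncomputable section

/-- The hermitian pairing on complex coordinate vectors determined by the (Gram) matrix `M`:
`⟨u, v⟩ = ∑ conj(uᵢ) · Mᵢⱼ · vⱼ` (antilinear in the first variable). -/
def cForm {ι : Type} [Fintype ι] (M : Matrix ι ι ℂ) (u v : ι → ℂ) : ℂ :=
  ∑ i, ∑ j, (starRingEnd ℂ) (u i) * M i j * v j

/-- The hermitian pairing, at the complex embedding `σ` of `K`, of two `K`-rational
coordinate vectors, for the metric with Gram matrix `M` at `σ`. -/
def eForm {K : Type} [Field K] {ι : Type} [Fintype ι] (M : Matrix ι ι ℂ)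
    (σ : K →+* ℂ) (u v : ι → K) : ℂ :=
  cForm M (fun i => σ (u i)) (fun i => σ (v i))

/-- The arithmetic degree of a (finitely generated) `𝒪_K`-submodule `F` of `K^ι`, for the
hermitian metrics on `K^ι` whose Gram matrix at the complex embedding `σ` is `H σ`, with the
induced metrics on `F`.  It is computed from a `K`-linearly independent family `x` of elements
of `F` spanning the same `K`-subspace as `F`:
`deg F = log #(F / (𝒪_K x₁ + ⋯ + 𝒪_K x_s)) - ∑_σ log ‖x₁ ∧ ⋯ ∧ x_s‖_σ`,
where `‖x₁ ∧ ⋯ ∧ x_s‖_σ` is the square root of the Gram determinant of `x` at `σ`.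
(For `F` of rank one this is the usual `deg F = log #(F/𝒪_K ℓ) - ∑_v ε_v log ‖ℓ‖_v`, the sum
running over all complex embeddings; the general case agrees with `deg F = deg (det F)`,
where `det F = Λ^s F` carries the Gram-determinant metrics.) -/
def hDeg (K : Type) [Field K] [NumberField K] {ι : Type} [Fintype ι]
    (H : (K →+* ℂ) → Matrix ι ι ℂ) (F : Submodule (𝓞 K) (ι → K)) : ℝ :=
  if h : ∃ p : (s : ℕ) × (Fin s → ι → K), 0 < p.1 ∧ (∀ a, p.2 a ∈ F) ∧
      LinearIndependent K p.2 ∧ ∀ y ∈ F, y ∈ Submodule.span K (Set.range p.2) then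
    Real.log (Nat.card
        (↥F ⧸ Submodule.comap F.subtype (Submodule.span (𝓞 K) (Set.range h.choose.2))))
      - ∑ᶠ σ : K →+* ℂ, Real.log (Real.sqrt
          ((Matrix.of fun a b => eForm (H σ) σ (h.choose.2 a) (h.choose.2 b)).det.re))
  else 0

/-- The rank of an `𝒪_K`-submodule `F` of `K^ι`: the dimension of the `K`-subspace
it spans. -/
def hRank (K : Type) [Field K] [NumberField K] {ι : Type} [Fintype ι]
    (F : Submodule (𝓞 K) (ι → K)) : ℕ :=
  Module.finrank K ↥(Submodule.span K (F : Set (ι → K)))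

/-- The slope of a nonzero `𝒪_K`-submodule of `K^ι` with the induced metrics:
degree divided by rank. -/
def hMu (K : Type) [Field K] [NumberField K] {ι : Type} [Fintype ι]
    (H : (K →+* ℂ) → Matrix ι ι ℂ) (F : Submodule (𝓞 K) (ι → K)) : ℝ :=
  hDeg K H F / hRank K F

/-- The maximal slope `μ_max` of the hermitian `𝒪_K`-lattice `E ⊆ K^ι`: the supremum of the
slopes of its nonzero `𝒪_K`-submodules (of any rank), with the induced metrics. -/
def hMuMax (K : Type) [Field K] [NumberField K] {ι : Type} [Fintype ι]
    (H : (K →+* ℂ) → Matrix ι ι ℂ) (E : Submodule (𝓞 K) (ι → K)) : ℝ :=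
  sSup { m : ℝ | ∃ F : Submodule (𝓞 K) (ι → K), F ≠ ⊥ ∧ F ≤ E ∧ m = hMu K H F }

/-- The compatibility of the family of Gram matrices `H` with complex conjugation:
the metric at the conjugate embedding is the conjugate metric (so that the data of `H`
amounts to a euclidean/hermitian metric at each archimedean place of `K`). -/
def ConjCompatible (K : Type) [Field K] {ι : Type} [Fintype ι]
    (H : (K →+* ℂ) → Matrix ι ι ℂ) : Prop :=
  ∀ σ : K →+* ℂ, H ((starRingEnd ℂ).comp σ) = (H σ).map (starRingEnd ℂ)

/-- The arithmetic degree of a nonzero rank-one hermitian `𝒪_K'`-lattice, presented as a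
nonzero finitely generated `𝒪_{K'}`-submodule `L` of `K'` whose metric at the complex
embedding `σ` is `‖y‖_σ² = g σ · |σ(y)|²`:
`deg L = log #(L/𝒪_{K'} ℓ) - ∑_σ log ‖ℓ‖_σ` for a nonzero `ℓ ∈ L`. -/
def degLine (K' : Type) [Field K'] [NumberField K']
    (L : Submodule (𝓞 K') K') (g : (K' →+* ℂ) → ℝ) : ℝ :=
  if h : ∃ x : K', x ∈ L ∧ x ≠ 0 then
    Real.log (Nat.card
        (↥L ⧸ Submodule.comap L.subtype (Submodule.span (𝓞 K') {h.choose})))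
      - ∑ᶠ σ : K' →+* ℂ, Real.log (Real.sqrt (g σ * Complex.normSq (σ h.choose)))
  else 0

/-- The quotient metric induced at the embedding `σ` on a rank-one quotient of the hermitian
lattice `(K'^ι, H')` via the `K'`-linear surjection `ψ : K'^ι → K'`:
`‖1‖² = inf { ⟨e, e⟩_{H' σ} | ψ_σ(e) = 1 }` (infimum over the fibre of `1` in `ℂ^ι`). -/
def quotMetric {K' : Type} [Field K'] {ι : Type} [Fintype ι] [DecidableEq ι]
    (H' : (K' →+* ℂ) → Matrix ι ι ℂ) (ψ : (ι → K') →ₗ[K'] K') (σ : K' →+* ℂ) : ℝ :=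
  sInf { t : ℝ | ∃ e : ι → ℂ, (∑ i, σ (ψ (Pi.single i 1)) * e i) = 1 ∧
    t = (cForm (H' σ) e e).re }

/-- Base change of an `𝒪_K`-lattice `E ⊆ K^ι` to the ring of integers of a finite
extension `K'` of `K`: the `𝒪_{K'}`-span of the image of `E` in `K'^ι`. -/
def baseChange (K K' : Type) [Field K] [NumberField K] [Field K'] [NumberField K']
    [Algebra K K'] {ι : Type} [Fintype ι] (E : Submodule (𝓞 K) (ι → K)) :
    Submodule (𝓞 K') (ι → K') :=
  Submodule.span (𝓞 K') ((fun v i => algebraMap K K' (v i)) '' (E : Set (ι → K)))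

/-- The metrics on the base change to `K'` of a hermitian lattice over `K` with metrics `H`:
the Gram matrix at an embedding `σ'` of `K'` is the Gram matrix of `H` at the induced
embedding of `K`. -/
def baseChangeMetric (K K' : Type) [Field K] [Field K'] [Algebra K K'] {ι : Type}
    (H : (K →+* ℂ) → Matrix ι ι ℂ) : (K' →+* ℂ) → Matrix ι ι ℂ :=
  fun σ' => H (σ'.comp (algebraMap K K'))

/-- A hermitian `𝒪_K`-lattice `E ⊆ K^ι` (with metrics `H`) is nef if for every finite
extension `K'/K`, every rank-one quotient of `E ⊗_{𝒪_K} 𝒪_{K'}`, with the quotient metrics,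
has nonnegative arithmetic degree.  A rank-one quotient is the image of `E ⊗ 𝒪_{K'}` under a
`K'`-linear form `ψ` on `K'^ι` (every rank-one quotient of the full lattice `E ⊗ 𝒪_{K'}`
arises this way, with the quotient metrics given by `quotMetric`). -/
def IsNef (K : Type) [Field K] [NumberField K] {ι : Type} [Fintype ι] [DecidableEq ι]
    (H : (K →+* ℂ) → Matrix ι ι ℂ) (E : Submodule (𝓞 K) (ι → K)) : Prop :=
  ∀ (K' : Type) [Field K'] [NumberField K'] [Algebra K K'],
    ∀ ψ : (ι → K') →ₗ[K'] K',
      Submodule.map (ψ.restrictScalars (𝓞 K')) (baseChange K K' E) ≠ ⊥ →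
      0 ≤ degLine K' (Submodule.map (ψ.restrictScalars (𝓞 K')) (baseChange K K' E))
            (quotMetric (baseChangeMetric K K' H) ψ)

end

section Index

variable {K : Type} [Field K] [NumberField K]

lemma card_quotient_comap_eq_relIndex {R M : Type} [Ring R] [AddCommGroup M] [Module R M]
    (F N : Submodule R M) :
    Nat.card (F ⧸ Submodule.comap F.subtype N) = N.toAddSubgroup.relIndex F.toAddSubgroup :=
  rfl

lemma absNorm_span_singleton_eq_prod_norm (z : 𝓞 K) :
    (Ideal.absNorm (Ideal.span {z}) : ℝ) = ∏ σ : K →+* ℂ, ‖σ z‖ := by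
  have h := congrArg (‖·‖) (Algebra.norm_eq_prod_embeddings ℚ ℂ (z : K))
  simp only [norm_prod] at h
  rw [Fintype.prod_equiv (RingHom.equivRatAlgHom K ℂ) (fun f => ‖f (z : K)‖)
      (fun φ => ‖φ (z : K)‖) fun _ => by simp [RingHom.equivRatAlgHom_apply], ← h,
    Ideal.absNorm_span_singleton, ← Algebra.coe_norm_int]
  simp [Nat.cast_natAbs]

lemma relIndex_smul_mul_absNorm {d : K} (hd : d ≠ 0) {L : Submodule (𝓞 K) K} {I : Ideal (𝓞 K)}
    (hI : L.toAddSubgroup.map (AddMonoidHom.mulLeft d) =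
      I.toAddSubgroup.map (algebraMap (𝓞 K) K).toAddMonoidHom)
    {x : K} (hx : x ∈ L) :
    ((Submodule.span (𝓞 K) {x}).toAddSubgroup.relIndex L.toAddSubgroup : ℝ) * Ideal.absNorm I =
      ∏ σ : K →+* ℂ, ‖σ (d * x)‖ := by
  have hinj : Function.Injective (algebraMap (𝓞 K) K).toAddMonoidHom :=
    NumberField.RingOfIntegers.coe_injective
  have hmem : d * x ∈ I.toAddSubgroup.map (algebraMap (𝓞 K) K).toAddMonoidHom :=
    hI ▸ ⟨x, hx, rfl⟩
  obtain ⟨z, hzI, hz⟩ := hmem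
  have hz : (z : K) = d * x := hz
  have hspan : (Submodule.span (𝓞 K) {x}).toAddSubgroup.map (AddMonoidHom.mulLeft d) =
      (Ideal.span {z}).toAddSubgroup.map (algebraMap (𝓞 K) K).toAddMonoidHom := by
    ext y
    constructor
    · rintro ⟨w, hw, rfl⟩
      obtain ⟨r, rfl⟩ := Submodule.mem_span_singleton.1 hw
      refine ⟨r * z, Ideal.mem_span_singleton'.2 ⟨r, rfl⟩, ?_⟩
      simp [hz, Algebra.smul_def]
      ring
    · rintro ⟨w, hw, rfl⟩
      obtain ⟨r, rfl⟩ := Ideal.mem_span_singleton'.1 hw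
      refine ⟨r • x, Submodule.mem_span_singleton.2 ⟨r, rfl⟩, ?_⟩
      simp [hz, Algebra.smul_def]
      ring
  rw [← AddSubgroup.relIndex_map_map_of_injective _ _ (f := AddMonoidHom.mulLeft d)
    (mul_right_injective₀ hd), hspan, hI,
    AddSubgroup.relIndex_map_map_of_injective _ _ hinj, ← hz,
    ← absNorm_span_singleton_eq_prod_norm, Ideal.absNorm_eq_index, Ideal.absNorm_eq_index,
    ← AddSubgroup.relIndex_mul_index (K := I.toAddSubgroup)
      (H := (Ideal.span {z}).toAddSubgroup)
      ((Ideal.span_singleton_le_iff_mem I).2 hzI)]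
  push_cast
  rfl

lemma exists_ideal_map_eq (L : Submodule (𝓞 K) K) (hL : L.FG) :
    ∃ d : K, d ≠ 0 ∧ ∃ I : Ideal (𝓞 K), L.toAddSubgroup.map (AddMonoidHom.mulLeft d) =
      I.toAddSubgroup.map (algebraMap (𝓞 K) K).toAddMonoidHom := by
  obtain ⟨s, rfl⟩ := hL
  obtain ⟨b, hb⟩ := IsLocalization.exist_integer_multiples_of_finset (nonZeroDivisors (𝓞 K)) s
  have hint : ∀ y ∈ Submodule.span (𝓞 K) (s : Set K),
      ∃ z : 𝓞 K, algebraMap (𝓞 K) K z = algebraMap (𝓞 K) K b * y := by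
    intro y hy
    induction hy using Submodule.span_induction with
    | mem y hy =>
      obtain ⟨z, hz⟩ := hb y hy
      exact ⟨z, by rw [hz, Algebra.smul_def]⟩
    | zero => exact ⟨0, by simp⟩
    | add y y' _ _ h h' =>
      obtain ⟨z, hz⟩ := h
      obtain ⟨z', hz'⟩ := h'
      exact ⟨z + z', by rw [map_add, hz, hz']; ring⟩
    | smul r y _ h =>
      obtain ⟨z, hz⟩ := h
      exact ⟨r * z, by rw [map_mul, hz, Algebra.smul_def]; ring⟩
  refine ⟨((b : 𝓞 K) : K), by simp, Submodule.comap (Algebra.linearMap (𝓞 K) K)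
    ((Submodule.span (𝓞 K) (s : Set K)).map (LinearMap.mulLeft (𝓞 K) ((b : 𝓞 K) : K))), ?_⟩
  ext y
  constructor
  · rintro ⟨w, hw, rfl⟩
    obtain ⟨z, hz⟩ := hint w hw
    exact ⟨z, ⟨w, hw, hz.symm⟩, hz⟩
  · rintro ⟨z, ⟨w, hw, hz⟩, rfl⟩
    exact ⟨w, hw, hz⟩

lemma prod_norm_le_card_quotient_mul {L : Submodule (𝓞 K) K} (hL : L.FG) {x y : K}
    (hx : x ∈ L) (hy : y ∈ L) (hy0 : y ≠ 0) :
    ∏ σ : K →+* ℂ, ‖σ x‖ ≤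
      Nat.card (L ⧸ Submodule.comap L.subtype (Submodule.span (𝓞 K) {x})) *
        ∏ σ : K →+* ℂ, ‖σ y‖ := by
  obtain ⟨d, hd, I, hI⟩ := exists_ideal_map_eq L hL
  have h1 := relIndex_smul_mul_absNorm hd hI hx
  have h2 := relIndex_smul_mul_absNorm hd hI hy
  simp only [map_mul, norm_mul, Finset.prod_mul_distrib] at h1 h2
  have hpos : ∀ z : K, z ≠ 0 → 0 < ∏ σ : K →+* ℂ, ‖σ z‖ := fun z hz =>
    Finset.prod_pos fun σ _ => norm_pos_iff.2 ((map_ne_zero σ).2 hz)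
  have hdp := hpos d hd
  have hyp := hpos y hy0
  rw [card_quotient_comap_eq_relIndex]
  set m := (Submodule.span (𝓞 K) {x}).toAddSubgroup.relIndex L.toAddSubgroup
  set k := (Submodule.span (𝓞 K) {y}).toAddSubgroup.relIndex L.toAddSubgroup
  have hk : (1 : ℝ) ≤ k := by
    have : k ≠ 0 := by
      intro h
      rw [h] at h2
      have := mul_pos hdp hyp
      simp at h2
      rcases h2 with h2 | h2
      · exact hdp.ne' (by rw [h2])
      · exact hyp.ne' (by rw [h2])
    exact_mod_cast Nat.one_le_iff_ne_zero.2 this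
  refine le_of_mul_le_mul_left ?_ hdp
  calc _ = (m : ℝ) * Ideal.absNorm I := h1.symm
    _ ≤ m * (k * Ideal.absNorm I) := by
        gcongr
        exact le_mul_of_one_le_left (Nat.cast_nonneg _) hk
    _ = _ := by rw [h2]; ring

lemma neg_sum_log_le_degLine {L : Submodule (𝓞 K) K} (hL : L.FG) {g : (K →+* ℂ) → ℝ}
    (hg : ∀ σ, 0 < g σ) {y : K} (hy : y ∈ L) (hy0 : y ≠ 0) :
    -∑ σ : K →+* ℂ, (Real.log ‖σ y‖ + Real.log (g σ) / 2) ≤ degLine K L g := by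
  have h : ∃ x : K, x ∈ L ∧ x ≠ 0 := ⟨y, hy, hy0⟩
  rw [degLine, dif_pos h, finsum_eq_sum_of_fintype]
  obtain ⟨hx, hx0⟩ := h.choose_spec
  set x := h.choose
  have hne : ∀ z : K, z ≠ 0 → ∀ σ : K →+* ℂ, ‖σ z‖ ≠ 0 := fun z hz σ =>
    norm_ne_zero_iff.2 ((map_ne_zero σ).2 hz)
  have hpos : ∀ z : K, z ≠ 0 → 0 < ∏ σ : K →+* ℂ, ‖σ z‖ := fun z hz =>
    Finset.prod_pos fun σ _ => norm_pos_iff.2 ((map_ne_zero σ).2 hz)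
  have hlog : ∀ σ : K →+* ℂ, Real.log (Real.sqrt (g σ * Complex.normSq (σ x))) =
      Real.log ‖σ x‖ + Real.log (g σ) / 2 := fun σ => by
    rw [Complex.normSq_eq_norm_sq, Real.log_sqrt (by have := (hg σ).le; positivity),
      Real.log_mul (hg σ).ne' (pow_ne_zero 2 (hne x hx0 σ)), Real.log_pow]
    push_cast
    ring
  simp only [hlog, Finset.sum_add_distrib]
  have hle := prod_norm_le_card_quotient_mul hL hx hy hy0
  have hcard : (Nat.card (L ⧸ Submodule.comap L.subtype (Submodule.span (𝓞 K) {x})) : ℝ) ≠ 0 := by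
    intro h0
    rw [h0, zero_mul] at hle
    exact absurd (hpos x hx0) hle.not_gt
  have := Real.log_le_log (hpos x hx0) hle
  rw [Real.log_mul hcard (hpos y hy0).ne', Real.log_prod (fun σ _ => hne x hx0 σ),
    Real.log_prod (fun σ _ => hne y hy0 σ)] at this
  linarith

end Index
section RootLattice

lemma three_mul_sum_log_le {x y z : ℝ} (hx : 0 < x) (hy : 0 < y) (hz : 0 < z) :
    Real.log x + Real.log y + Real.log z ≤ 3 * Real.log ((x + y + z) / 3) := by
  have hm : 0 < (x + y + z) / 3 := by positivity
  have key : ∀ t : ℝ, 0 < t → Real.log t - Real.log ((x + y + z) / 3) ≤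
      t / ((x + y + z) / 3) - 1 := fun t ht => by
    rw [← Real.log_div ht.ne' hm.ne']
    exact Real.log_le_sub_one_of_pos (by positivity)
  have hsum : x / ((x + y + z) / 3) + y / ((x + y + z) / 3) + z / ((x + y + z) / 3) = 3 := by
    field_simp
  linarith [key x hx, key y hy, key z hz]

lemma cForm_smul_a2_re (c : ℝ) (e : Fin 2 → ℂ) :
    (cForm ((c : ℂ) • !![2, 1; 1, 2]) e e).re =
      c * (‖e 0‖ ^ 2 + ‖e 1‖ ^ 2 + ‖e 0 + e 1‖ ^ 2) := by
  simp [cForm, Fin.sum_univ_two, ← Complex.normSq_eq_norm_sq, Complex.normSq_apply]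
  ring

lemma a2_cauchy_schwarz (a b x y : ℂ) (h : a * x + b * y = 1) :
    3 ≤ (‖x‖ ^ 2 + ‖y‖ ^ 2 + ‖x + y‖ ^ 2) * (‖a‖ ^ 2 + ‖b‖ ^ 2 + ‖a - b‖ ^ 2) := by
  have hdual : ‖2 * a - b‖ ^ 2 + ‖2 * b - a‖ ^ 2 + ‖a + b‖ ^ 2 =
      3 * (‖a‖ ^ 2 + ‖b‖ ^ 2 + ‖a - b‖ ^ 2) := by
    simp [← Complex.normSq_eq_norm_sq, Complex.normSq_apply]
    ring
  have h3 : (2 * a - b) * x + (2 * b - a) * y + (a + b) * (x + y) = 3 := by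
    linear_combination 3 * h
  have hle : 3 ≤ ‖2 * a - b‖ * ‖x‖ + ‖2 * b - a‖ * ‖y‖ + ‖a + b‖ * ‖x + y‖ := by
    have := norm_add₃_le (a := (2 * a - b) * x) (b := (2 * b - a) * y) (c := (a + b) * (x + y))
    rw [h3] at this
    simpa only [norm_mul, Complex.norm_ofNat] using this
  have hcs : ∀ p q r u v w : ℝ, (p * u + q * v + r * w) ^ 2 ≤
      (p ^ 2 + q ^ 2 + r ^ 2) * (u ^ 2 + v ^ 2 + w ^ 2) := fun p q r u v w => by
    nlinarith [sq_nonneg (p * v - q * u), sq_nonneg (p * w - r * u), sq_nonneg (q * w - r * v)]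
  have := hcs ‖2 * a - b‖ ‖2 * b - a‖ ‖a + b‖ ‖x‖ ‖y‖ ‖x + y‖
  rw [hdual] at this
  nlinarith

lemma quotMetric_smul_a2 {K : Type} [Field K] (c : ℝ) (hc : 0 < c)
    (H : (K →+* ℂ) → Matrix (Fin 2) (Fin 2) ℂ) (hH : ∀ σ, H σ = (c : ℂ) • !![2, 1; 1, 2])
    (ψ : (Fin 2 → K) →ₗ[K] K) (σ : K →+* ℂ) (a b : ℂ)
    (ha : σ (ψ (Pi.single 0 1)) = a) (hb : σ (ψ (Pi.single 1 1)) = b)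
    (hab : a ≠ 0 ∨ b ≠ 0) :
    quotMetric H ψ σ = c * (3 / (‖a‖ ^ 2 + ‖b‖ ^ 2 + ‖a - b‖ ^ 2)) := by
  have hS : 0 < ‖a‖ ^ 2 + ‖b‖ ^ 2 + ‖a - b‖ ^ 2 := by
    rcases hab with h | h
    · have := norm_pos_iff.2 h
      positivity
    · have := norm_pos_iff.2 h
      positivity
  set S := ‖a‖ ^ 2 + ‖b‖ ^ 2 + ‖a - b‖ ^ 2 with hSdef
  refine IsLeast.csInf_eq ⟨?_, ?_⟩
  · refine ⟨![starRingEnd ℂ (2 * a - b) / S, starRingEnd ℂ (2 * b - a) / S], ?_, ?_⟩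
    · have hSC : (S : ℂ) = a * starRingEnd ℂ a + b * starRingEnd ℂ b +
          (a - b) * starRingEnd ℂ (a - b) := by
        simp only [hSdef, Complex.mul_conj']
        push_cast
        rfl
      have hS0 : (S : ℂ) ≠ 0 := by exact_mod_cast hS.ne'
      simp only [Fin.sum_univ_two, ha, hb, Matrix.cons_val_zero, Matrix.cons_val_one]
      field_simp
      rw [hSC]
      simp only [map_sub, map_mul, Complex.conj_ofNat]
      ring
    · rw [hH, cForm_smul_a2_re]
      congr 1
      have hnum : ‖2 * a - b‖ ^ 2 + ‖2 * b - a‖ ^ 2 + ‖a + b‖ ^ 2 = 3 * S := by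
        simp [hSdef, ← Complex.normSq_eq_norm_sq, Complex.normSq_apply]
        ring
      have hsum : starRingEnd ℂ (2 * a - b) / S + starRingEnd ℂ (2 * b - a) / S =
          starRingEnd ℂ (a + b) / S := by
        simp only [map_sub, map_mul, map_add, Complex.conj_ofNat]
        ring
      simp only [Matrix.cons_val_zero, Matrix.cons_val_one, hsum, norm_div, RCLike.norm_conj,
        Complex.norm_real, Real.norm_eq_abs, abs_of_pos hS, div_pow, ← add_div, hnum]
      field_simp
  · rintro t ⟨e, he, rfl⟩
    rw [hH, cForm_smul_a2_re]
    rw [Fin.sum_univ_two, ha, hb] at he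
    gcongr
    rw [div_le_iff₀ hS]
    exact a2_cauchy_schwarz a b _ _ he

lemma map_baseChange_standard {K : Type} [Field K] [NumberField K] [Algebra ℚ K]
    (ψ : (Fin 2 → K) →ₗ[K] K) :
    Submodule.map (ψ.restrictScalars (𝓞 K)) (baseChange ℚ K (Submodule.span (𝓞 ℚ)
      (Set.range fun i : Fin 2 => (Pi.single i 1 : Fin 2 → ℚ)))) =
      Submodule.span (𝓞 K) {ψ (Pi.single 0 1), ψ (Pi.single 1 1)} := by
  have hsingle : ∀ i : Fin 2, (fun j => algebraMap ℚ K ((Pi.single i 1 : Fin 2 → ℚ) j)) =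
      Pi.single i 1 := fun i => by
    ext j
    by_cases h : j = i
    · subst h; simp
    · simp [h]
  rw [baseChange, Submodule.map_span]
  refine le_antisymm (Submodule.span_le.2 ?_) (Submodule.span_le.2 ?_)
  · rintro _ ⟨_, ⟨v, hv, rfl⟩, rfl⟩
    induction hv using Submodule.span_induction with
    | mem v hv =>
      obtain ⟨i, rfl⟩ := hv
      simp only [hsingle]
      refine Submodule.subset_span ?_
      fin_cases i <;> simp
    | zero =>
      have : (fun i => algebraMap ℚ K ((0 : Fin 2 → ℚ) i)) = 0 := by
        ext i; simp
      beta_reduce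
      rw [this, map_zero]
      exact Submodule.zero_mem _
    | add v w _ _ hv hw =>
      have : (fun i => algebraMap ℚ K ((v + w) i)) =
          (fun i => algebraMap ℚ K (v i)) + fun i => algebraMap ℚ K (w i) := by
        ext i; simp
      beta_reduce
      rw [this, map_add]
      exact Submodule.add_mem _ hv hw
    | smul r v _ hv =>
      have : (fun i => algebraMap ℚ K ((r • v) i)) =
          NumberField.RingOfIntegers.mapRingHom (algebraMap ℚ K) r •
            fun i => algebraMap ℚ K (v i) := by
        ext i; simp [Algebra.smul_def]
      beta_reduce
      rw [this, map_smul]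
      exact Submodule.smul_mem _ _ hv
  · rintro _ (rfl | rfl)
    · exact Submodule.subset_span ⟨_, ⟨_, Submodule.subset_span ⟨0, rfl⟩, rfl⟩,
        by simp only [hsingle]; rfl⟩
    · exact Submodule.subset_span ⟨_, ⟨_, Submodule.subset_span ⟨1, rfl⟩, rfl⟩,
        by simp only [hsingle]; rfl⟩

lemma toAddSubgroup_span_ringOfIntegers_rat {M : Type} [AddCommGroup M] [Module (𝓞 ℚ) M]
    (s : Set M) : (Submodule.span (𝓞 ℚ) s).toAddSubgroup = AddSubgroup.closure s := by
  refine le_antisymm (fun x (hx : x ∈ Submodule.span (𝓞 ℚ) s) => ?_)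
    ((AddSubgroup.closure_le _).2 Submodule.subset_span)
  induction hx using Submodule.span_induction with
  | mem x hx => exact AddSubgroup.subset_closure hx
  | zero => exact zero_mem _
  | add x y _ _ hx hy => exact add_mem hx hy
  | smul r x _ hx =>
    obtain ⟨n, rfl⟩ := Rat.ringOfIntegersEquiv.symm.surjective r
    rw [eq_intCast, Int.cast_smul_eq_zsmul]
    exact zsmul_mem hx n

lemma hDeg_standard_smul_a2 (c : ℝ) (hc : 0 < c) (H : (ℚ →+* ℂ) → Matrix (Fin 2) (Fin 2) ℂ)
    (hH : ∀ σ, H σ = (c : ℂ) • !![2, 1; 1, 2]) :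
    hDeg ℚ H (Submodule.span (𝓞 ℚ)
      (Set.range fun i : Fin 2 => (Pi.single i 1 : Fin 2 → ℚ))) =
      -(Real.log c + Real.log 3 / 2) := by
  set E := Submodule.span (𝓞 ℚ) (Set.range fun i : Fin 2 => (Pi.single i 1 : Fin 2 → ℚ)) with hE
  have h : ∃ p : (s : ℕ) × (Fin s → Fin 2 → ℚ), 0 < p.1 ∧ (∀ a, p.2 a ∈ E) ∧
      LinearIndependent ℚ p.2 ∧ ∀ y ∈ E, y ∈ Submodule.span ℚ (Set.range p.2) := by
    refine ⟨⟨2, Pi.basisFun ℚ (Fin 2)⟩, by norm_num, fun a => ?_,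
      (Pi.basisFun ℚ (Fin 2)).linearIndependent, fun y _ => ?_⟩
    · exact Submodule.subset_span ⟨a, by simp⟩
    · rw [(Pi.basisFun ℚ (Fin 2)).span_eq]
      trivial
  rw [hDeg, dif_pos h]
  have hspec := h.choose_spec
  generalize h.choose = p at hspec ⊢
  obtain ⟨s, x⟩ := p
  obtain ⟨-, hmem, hli, hspan⟩ := hspec
  dsimp only at hmem hli hspan ⊢
  have htop : ⊤ ≤ Submodule.span ℚ (Set.range x) := by
    rw [← (Pi.basisFun ℚ (Fin 2)).span_eq, Submodule.span_le]
    rintro _ ⟨i, rfl⟩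
    exact hspan _ (Submodule.subset_span ⟨i, (Pi.basisFun_apply ℚ (Fin 2) i).symm⟩)
  let B := Module.Basis.mk hli htop
  obtain rfl : s = 2 := by
    have := Module.finrank_eq_card_basis B
    simpa using this.symm
  have hindex := AddSubgroup.relIndex_eq_abs_det (Submodule.span (𝓞 ℚ) (Set.range x)).toAddSubgroup
    E.toAddSubgroup (fun y hy => (Submodule.span_le.2 (by rintro _ ⟨i, rfl⟩; exact hmem i) :
      Submodule.span (𝓞 ℚ) (Set.range x) ≤ E) hy) B (Pi.basisFun ℚ (Fin 2))
    (by rw [toAddSubgroup_span_ringOfIntegers_rat]; simp [B])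
    (by
      rw [hE, toAddSubgroup_span_ringOfIntegers_rat]
      congr 2
      ext i
      simp)
  set D := (Pi.basisFun ℚ (Fin 2)).det B with hD
  have hD0 : D ≠ 0 := ((Pi.basisFun ℚ (Fin 2)).isUnit_det B).ne_zero
  have hDx : D = x 0 0 * x 1 1 - x 1 0 * x 0 1 := by
    rw [hD, Module.Basis.det_apply, Matrix.det_fin_two]
    simp only [Module.Basis.toMatrix_apply, B, Module.Basis.mk_apply, Pi.basisFun_repr]
  have hgram : ∀ σ : ℚ →+* ℂ, (Matrix.of fun a b => eForm (H σ) σ (x a) (x b)).det.re =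
      3 * (c * |(D : ℝ)|) ^ 2 := fun σ => by
    rw [mul_pow, sq_abs, hDx, Matrix.det_fin_two]
    simp only [Matrix.of_apply, eForm, cForm, hH, Fin.sum_univ_two, eq_ratCast]
    have : ((3 * (c ^ 2 * ((x 0 0 * x 1 1 - x 1 0 * x 0 1 : ℚ) : ℝ) ^ 2) : ℝ) : ℂ).re =
      3 * (c ^ 2 * ((x 0 0 * x 1 1 - x 1 0 * x 0 1 : ℚ) : ℝ) ^ 2) := Complex.ofReal_re _
    rw [← this]
    congr 1
    simp
    ring
  have hDpos : 0 < |(D : ℝ)| := abs_pos.2 (by exact_mod_cast hD0)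
  have hcard : (Nat.card (E ⧸ Submodule.comap E.subtype
      (Submodule.span (𝓞 ℚ) (Set.range x))) : ℝ) = |(D : ℝ)| := by
    rw [card_quotient_comap_eq_relIndex]
    exact_mod_cast congrArg (fun q : ℚ => (q : ℝ)) hindex
  rw [hcard, finsum_eq_sum_of_fintype]
  simp only [hgram]
  rw [Finset.sum_const, Finset.card_univ, NumberField.Embeddings.card, Module.finrank_self,
    one_smul, Real.log_sqrt (by positivity), Real.log_mul (by norm_num) (by positivity),
    Real.log_pow, Real.log_mul hc.ne' hDpos.ne']
  push_cast
  ring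

lemma isNef_standard_smul_a2 (lam : ℝ) (hlam : (1 / 2) * Real.log (3 / 2) ≤ lam)
    (H : (ℚ →+* ℂ) → Matrix (Fin 2) (Fin 2) ℂ)
    (hH : ∀ σ, H σ = (Real.exp (-(2 * lam)) : ℂ) • !![2, 1; 1, 2]) :
    IsNef ℚ H (Submodule.span (𝓞 ℚ)
      (Set.range fun i : Fin 2 => (Pi.single i 1 : Fin 2 → ℚ))) := by
  intro K _ _ _ ψ hne
  rw [map_baseChange_standard] at hne ⊢
  set a := ψ (Pi.single 0 1) with ha
  set b := ψ (Pi.single 1 1) with hb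
  set L := Submodule.span (𝓞 K) {a, b}
  have hL : L.FG := Submodule.fg_span (by simp)
  have haL : a ∈ L := Submodule.subset_span (by simp)
  have hbL : b ∈ L := Submodule.subset_span (by simp)
  have hab : a ≠ 0 ∨ b ≠ 0 := by
    by_contra! h
    exact hne (by simp [L, h.1, h.2])
  set g := quotMetric (baseChangeMetric ℚ K H) ψ
  have hlam0 : 0 < lam := by
    have := Real.log_pos (x := 3 / 2) (by norm_num)
    linarith
  have hS : ∀ σ : K →+* ℂ, 0 < ‖σ a‖ ^ 2 + ‖σ b‖ ^ 2 + ‖σ a - σ b‖ ^ 2 := fun σ => by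
    rcases hab with h | h <;>
    · have := norm_pos_iff.2 ((map_ne_zero σ).2 h)
      positivity
  have hgval : ∀ σ : K →+* ℂ, g σ = Real.exp (-(2 * lam)) *
      (3 / (‖σ a‖ ^ 2 + ‖σ b‖ ^ 2 + ‖σ a - σ b‖ ^ 2)) := fun σ =>
    quotMetric_smul_a2 _ (Real.exp_pos _) _ (fun σ => hH _) ψ σ _ _ rfl rfl
      (hab.imp (map_ne_zero σ).2 (map_ne_zero σ).2)
  have hg : ∀ σ, 0 < g σ := fun σ => by
    rw [hgval]
    have := hS σ
    positivity
  have hlog : ∀ σ, Real.log (g σ) =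
      -(2 * lam) - Real.log ((‖σ a‖ ^ 2 + ‖σ b‖ ^ 2 + ‖σ a - σ b‖ ^ 2) / 3) := fun σ => by
    rw [hgval, Real.log_mul (Real.exp_pos _).ne' (div_ne_zero (by norm_num) (hS σ).ne'),
      Real.log_exp, ← inv_div, Real.log_inv]
    ring
  have hdeg : ∀ y : K, y ∈ L → y ≠ 0 →
      (∀ σ : K →+* ℂ, ‖σ a‖ ^ 2 + ‖σ b‖ ^ 2 + ‖σ a - σ b‖ ^ 2 = 2 * ‖σ y‖ ^ 2) →
      0 ≤ degLine K L g := fun y hy hy0 h => by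
    refine le_trans ?_ (neg_sum_log_le_degLine hL hg hy hy0)
    rw [neg_nonneg]
    refine Finset.sum_nonpos fun σ _ => ?_
    have hσ := norm_pos_iff.2 ((map_ne_zero σ).2 hy0)
    rw [hlog, h, show 2 * ‖σ y‖ ^ 2 / 3 = (3 / 2)⁻¹ * ‖σ y‖ ^ 2 by ring,
      Real.log_mul (by norm_num) (by positivity), Real.log_inv, Real.log_pow]
    push_cast
    linarith
  by_cases ha0 : a = 0
  · exact hdeg b hbL (by tauto) fun σ => by simp [ha0]; ring
  by_cases hb0 : b = 0
  · exact hdeg a haL ha0 fun σ => by simp [hb0]; ring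
  by_cases hc0 : a - b = 0
  · exact hdeg a haL ha0 fun σ => by simp [sub_eq_zero.1 hc0]; ring
  have h1 := neg_sum_log_le_degLine hL hg haL ha0
  have h2 := neg_sum_log_le_degLine hL hg hbL hb0
  have h3 := neg_sum_log_le_degLine hL hg (L.sub_mem haL hbL) hc0
  have hsum : ∑ σ : K →+* ℂ, ((Real.log ‖σ a‖ + Real.log (g σ) / 2) +
      (Real.log ‖σ b‖ + Real.log (g σ) / 2) +
      (Real.log ‖σ (a - b)‖ + Real.log (g σ) / 2)) ≤ 0 := by
    refine Finset.sum_nonpos fun σ _ => ?_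
    have hσ : ∀ y : K, y ≠ 0 → 0 < ‖σ y‖ ^ 2 := fun y hy =>
      pow_pos (norm_pos_iff.2 ((map_ne_zero σ).2 hy)) 2
    have := three_mul_sum_log_le (hσ a ha0) (hσ b hb0) (hσ (a - b) hc0)
    simp only [Real.log_pow] at this
    rw [hlog, ← map_sub]
    push_cast at this
    linarith
  rw [Finset.sum_add_distrib, Finset.sum_add_distrib] at hsum
  linarith

end RootLattice

/-- Let `𝔸₂` be the euclidean lattice (i.e. hermitian `𝒪_ℚ`-lattice) of
rank 2 with Gram matrix `[[2,1],[1,2]]` — the standard lattice `𝒪_ℚ² ⊆ ℚ²` with metric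
`[[2,1],[1,2]]` — and fix `λ ∈ [½·log(3/2), ¼·log 3)`.  Then the rescaled lattice `𝔸₂⟨λ⟩`
(all norms multiplied by `e^{-λ}`, i.e. Gram matrix multiplied by `e^{-2λ}`) is nef, and its
degree `2λ - ½·log 3` is negative.  In particular a nef hermitian lattice may have negative
degree. -/
theorem a2_twisted_nef_neg_degree (lam : ℝ)
    (hlam : (1 / 2) * Real.log (3 / 2) ≤ lam ∧ lam < Real.log 3 / 4)
    (E : Submodule (𝓞 ℚ) (Fin 2 → ℚ))
    (hE : E = Submodule.span (𝓞 ℚ) (Set.range fun i : Fin 2 => (Pi.single i 1 : Fin 2 → ℚ)))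
    (H : (ℚ →+* ℂ) → Matrix (Fin 2) (Fin 2) ℂ)
    (hH : H = fun _ => (Real.exp (-(2 * lam)) : ℂ) • !![2, 1; 1, 2]) :
    IsNef ℚ H E ∧ hDeg ℚ H E = 2 * lam - Real.log 3 / 2 ∧ hDeg ℚ H E < 0 := by
  subst hE hH
  have hdeg : hDeg ℚ (fun _ => (Real.exp (-(2 * lam)) : ℂ) • !![2, 1; 1, 2])
      (Submodule.span (𝓞 ℚ) (Set.range fun i : Fin 2 => (Pi.single i 1 : Fin 2 → ℚ))) =
      2 * lam - Real.log 3 / 2 := by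
    rw [hDeg_standard_smul_a2 _ (Real.exp_pos _) _ fun _ => rfl, Real.log_exp]
    ring
  refine ⟨isNef_standard_smul_a2 lam hlam.1 _ fun _ => rfl, hdeg, ?_⟩
  rw [hdeg]
  linarith [hlam.2]
end

section
/- Let 𝔸₂ be the euclidean lattice of rank 2 with Gram matrix [[2,1],[1,2]], and fix λ ∈ [ (1/2)·log(3/2), (1/4)·log 3 ). Then the orthogonal sum 𝔸₂⟨λ⟩ ⊥ ℤ̄⟨ (1/2)·log 3 − 2λ ⟩, where ℤ̄ is the unit euclidean lattice of rank one, is a nef euclidean lattice of degree 0 which is not semistable. In particular, a nef hermitian lattice of degree zero need not be semistable. -/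
open scoped NumberField ComplexOrder Classical

theorem prod_norm_embeddings_eq_abs_norm (K : Type) [Field K] [NumberField K] (y : K) :
    ∏ σ : K →+* ℂ, ‖σ y‖ = |(Algebra.norm ℚ y : ℝ)| := by
  have h := Algebra.norm_eq_prod_embeddings ℚ ℂ y
  have h2 : ∏ σ : K →+* ℂ, σ y = ∏ σ : K →ₐ[ℚ] ℂ, σ y :=
    Fintype.prod_equiv (RingHom.equivRatAlgHom K ℂ) _ _ fun _ => rfl
  rw [← norm_prod, h2, ← h]
  simp

theorem prod_norm_embeddings_integer (K : Type) [Field K] [NumberField K] (z : 𝓞 K) :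
    ∏ σ : K →+* ℂ, ‖σ (z : K)‖ = (Ideal.absNorm (Ideal.span {z}) : ℝ) := by
  rw [prod_norm_embeddings_eq_abs_norm, Ideal.absNorm_span_singleton, ← Algebra.coe_norm_int,
    Nat.cast_natAbs]
  simp

/-- The index `#(L / 𝒪_K x)` is at least `|N(x)| / |N(y)|` for every nonzero `y ∈ L`. -/
theorem prod_norm_le_mul_card_quotient (K : Type) [Field K] [NumberField K]
    (L : Submodule (𝓞 K) K) (d : 𝓞 K) (hd : d ≠ 0)
    (hdL : ∀ l ∈ L, ∃ z : 𝓞 K, (z : K) = d * l) (x y : K) (hx : x ∈ L) (hy : y ∈ L)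
    (hy0 : y ≠ 0) :
    ∏ σ : K →+* ℂ, ‖σ x‖ ≤ (∏ σ : K →+* ℂ, ‖σ y‖) *
      Nat.card (↥L ⧸ Submodule.comap L.subtype (Submodule.span (𝓞 K) {x})) := by
  have hinj : Function.Injective (algebraMap (𝓞 K) K) := NumberField.RingOfIntegers.coe_injective
  choose f hf using fun l : L => hdL l l.2
  let g : L →ₗ[𝓞 K] 𝓞 K :=
    { toFun := f
      map_add' := fun a b => hinj (by simp [hf, mul_add])
      map_smul' := fun r a => hinj (by
        simp only [hf, map_mul, smul_eq_mul, Submodule.coe_smul, RingHom.id_apply, Algebra.smul_def]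
        ring) }
  have hg : ∀ l : L, ((g l : 𝓞 K) : K) = d * l := hf
  have hd' : (d : K) ≠ 0 := by simpa using hd
  have hginj : Function.Injective g := fun a b hab => by
    have h1 := hg a
    rw [hab, hg b] at h1
    exact Subtype.ext (mul_left_cancel₀ hd' h1.symm)
  set A := Submodule.comap L.subtype (Submodule.span (𝓞 K) {x}) with hA
  have hA' : A = Submodule.span (𝓞 K) {(⟨x, hx⟩ : L)} := by
    apply Submodule.map_injective_of_injective L.injective_subtype
    rw [hA, Submodule.map_comap_eq, Submodule.map_span, Submodule.range_subtype]
    simpa using hx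
  have hmap : A.map g = Ideal.span {g ⟨x, hx⟩} := by
    rw [hA', Submodule.map_span, Set.image_singleton]
  have hidx := AddSubgroup.index_map_of_injective A.toAddSubgroup (f := g.toAddMonoidHom) hginj
  have h1 : Ideal.absNorm (Ideal.span {g ⟨x, hx⟩}) =
      Nat.card (↥L ⧸ A) * Ideal.absNorm (LinearMap.range g) := by
    rw [← hmap]
    exact hidx
  have h2 : Ideal.absNorm (LinearMap.range g) ≤ Ideal.absNorm (Ideal.span {g ⟨y, hy⟩}) := by
    refine Nat.le_of_dvd ?_ (Ideal.absNorm_dvd_absNorm_of_le ?_)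
    · rw [Nat.pos_iff_ne_zero, Ne, Ideal.absNorm_eq_zero_iff, Ideal.span_singleton_eq_bot]
      intro h0
      have := hg ⟨y, hy⟩
      rw [h0] at this
      simp [hy0, hd] at this
    · rw [Ideal.span_singleton_le_iff_mem]
      exact ⟨_, rfl⟩
  have hpos : 0 < ∏ σ : K →+* ℂ, ‖σ (d : K)‖ := Finset.prod_pos fun σ _ => by simpa using hd
  have h3 : ∀ l : L, (Ideal.absNorm (Ideal.span {g l}) : ℝ) =
      (∏ σ : K →+* ℂ, ‖σ (d : K)‖) * ∏ σ : K →+* ℂ, ‖σ (l : K)‖ := fun l => by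
    rw [← prod_norm_embeddings_integer, hg, ← Finset.prod_mul_distrib]
    simp
  refine le_of_mul_le_mul_left ?_ hpos
  rw [← mul_assoc, ← h3 ⟨x, hx⟩, ← h3 ⟨y, hy⟩, h1]
  push_cast
  rw [mul_comm]
  gcongr

/-- A criterion for nonnegativity of the degree of a rank-one lattice: it contains three nonzero
elements whose norms have product at most one at every embedding. -/
theorem degLine_nonneg (K : Type) [Field K] [NumberField K]
    (L : Submodule (𝓞 K) K) (g : (K →+* ℂ) → ℝ) (d : 𝓞 K) (hd : d ≠ 0)
    (hdL : ∀ l ∈ L, ∃ z : 𝓞 K, (z : K) = d * l) (y : Fin 3 → K) (hy : ∀ i, y i ∈ L)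
    (hy0 : ∀ i, y i ≠ 0) (hg0 : ∀ σ, 0 < g σ)
    (hg : ∀ σ : K →+* ℂ, g σ ^ 3 * ∏ i, Complex.normSq (σ (y i)) ≤ 1) :
    0 ≤ degLine K L g := by
  have h : ∃ x : K, x ∈ L ∧ x ≠ 0 := ⟨y 0, hy 0, hy0 0⟩
  rw [degLine, dif_pos h]
  obtain ⟨hx, hx0⟩ := h.choose_spec
  generalize h.choose = x at hx hx0
  set n := Nat.card (↥L ⧸ Submodule.comap L.subtype (Submodule.span (𝓞 K) {x})) with hn
  have hpos : ∀ z : K, z ≠ 0 → ∀ σ : K →+* ℂ, 0 < ‖σ z‖ := fun z hz σ => by simpa using hz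
  have hsum : ∀ i, ∑ σ : K →+* ℂ, Real.log ‖σ x‖ ≤
      ∑ σ : K →+* ℂ, Real.log ‖σ (y i)‖ + Real.log n := fun i => by
    have h1 := prod_norm_le_mul_card_quotient K L d hd hdL x (y i) hx (hy i) (hy0 i)
    rw [← hn] at h1
    have hxp : 0 < ∏ σ : K →+* ℂ, ‖σ x‖ := Finset.prod_pos fun σ _ => hpos x hx0 σ
    have hyp : 0 < ∏ σ : K →+* ℂ, ‖σ (y i)‖ := Finset.prod_pos fun σ _ => hpos _ (hy0 i) σ
    have hn0 : (n : ℝ) ≠ 0 := fun h0 => by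
      rw [h0, mul_zero] at h1
      exact absurd h1 (not_le.2 hxp)
    have h2 := Real.log_le_log hxp h1
    rw [Real.log_mul hyp.ne' hn0, Real.log_prod fun σ _ => (hpos x hx0 σ).ne',
      Real.log_prod fun σ _ => (hpos _ (hy0 i) σ).ne'] at h2
    exact h2
  have hterm : ∀ σ : K →+* ℂ, 3 * Real.log (Real.sqrt (g σ * Complex.normSq (σ x))) ≤
      3 * Real.log ‖σ x‖ - ∑ i, Real.log ‖σ (y i)‖ := fun σ => by
    have hgs := hg0 σ
    have hxs := hpos x hx0 σ
    have hys : ∀ i, 0 < ‖σ (y i)‖ := fun i => hpos _ (hy0 i) σ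
    have h1 := hg σ
    simp only [Complex.normSq_eq_norm_sq] at h1 ⊢
    have h2 := Real.log_le_log (mul_pos (pow_pos hgs 3)
      (Finset.prod_pos fun i _ => pow_pos (hys i) 2)) h1
    rw [Real.log_one, Real.log_mul (pow_pos hgs 3).ne'
      (Finset.prod_pos fun i _ => pow_pos (hys i) 2).ne',
      Real.log_prod fun i _ => (pow_pos (hys i) 2).ne', Real.log_pow] at h2
    simp only [Real.log_pow, ← Finset.mul_sum] at h2
    rw [Real.log_sqrt (by positivity), Real.log_mul hgs.ne' (by positivity), Real.log_pow]
    push_cast at h2 ⊢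
    linarith
  have htot := Finset.sum_le_sum fun σ (_ : σ ∈ Finset.univ) => hterm σ
  rw [← Finset.mul_sum, Finset.sum_sub_distrib, ← Finset.mul_sum, Finset.sum_comm] at htot
  rw [finsum_eq_sum_of_fintype]
  have h0 := hsum 0
  have h1 := hsum 1
  have h2 := hsum 2
  rw [Fin.sum_univ_three] at htot
  linarith

/-- The Gram matrix of the orthogonal sum of `𝔸₂` scaled by `s` and a line of square norm `t`. -/
def blockGram (s t : ℝ) : Matrix (Fin 3) (Fin 3) ℝ :=
  !![2 * s, s, 0; s, 2 * s, 0; 0, 0, t]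

theorem cForm_blockGram_re (s t : ℝ) (e : Fin 3 → ℂ) :
    (cForm ((blockGram s t).map Complex.ofReal) e e).re =
      s * (Complex.normSq (e 0) + Complex.normSq (e 1) + Complex.normSq (e 0 + e 1)) +
        t * Complex.normSq (e 2) := by
  simp [cForm, blockGram, Fin.sum_univ_three, Complex.normSq_apply]
  ring

section quotMetric

variable {K : Type} [Field K] (s t : ℝ) (ψ : (Fin 3 → K) →ₗ[K] K) (σ : K →+* ℂ)

theorem quotMetric_blockGram_le (hs : 0 < s) (ht : 0 < t) (e : Fin 3 → ℂ)
    (he : ∑ i, σ (ψ (Pi.single i 1)) * e i = 1) :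
    quotMetric (fun _ => (blockGram s t).map Complex.ofReal) ψ σ ≤
      s * (Complex.normSq (e 0) + Complex.normSq (e 1) + Complex.normSq (e 0 + e 1)) +
        t * Complex.normSq (e 2) := by
  refine csInf_le ⟨0, ?_⟩ ⟨e, he, (cForm_blockGram_re s t e).symm⟩
  rintro _ ⟨e, -, rfl⟩
  rw [cForm_blockGram_re]
  have h := fun z => Complex.normSq_nonneg z
  have := h (e 0)
  have := h (e 1)
  have := h (e 0 + e 1)
  have := h (e 2)
  positivity

theorem quotMetric_blockGram_pos (hs : 0 < s) (ht : 0 < t) (i : Fin 3)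
    (hi : ψ (Pi.single i 1) ≠ 0) :
    0 < quotMetric (fun _ => (blockGram s t).map Complex.ofReal) ψ σ := by
  set w : Fin 3 → ℂ := fun i => σ (ψ (Pi.single i 1)) with hw
  have hwi : w i ≠ 0 := by simpa [hw] using hi
  set C : ℝ := 3 * (Complex.normSq (w 0) / s + Complex.normSq (w 1) / s +
    Complex.normSq (w 2) / t) with hC
  have h0 : ∀ z, 0 ≤ Complex.normSq z := Complex.normSq_nonneg
  have hC0 : 0 < C := by
    have ha := div_nonneg (h0 (w 0)) hs.le
    have hb := div_nonneg (h0 (w 1)) hs.le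
    have hc := div_nonneg (h0 (w 2)) ht.le
    have hp := Complex.normSq_pos.2 hwi
    fin_cases i
    · have := div_pos hp hs
      simp only [Fin.zero_eta] at this
      linarith
    · have := div_pos hp hs
      simp only [Fin.mk_one] at this
      linarith
    · have := div_pos hp ht
      simp only [Fin.reduceFinMk] at this
      linarith
  refine lt_of_lt_of_le (inv_pos.2 hC0) (le_csInf ⟨_, Pi.single i (w i)⁻¹, ?_, rfl⟩ ?_)
  · rw [Finset.sum_eq_single i]
    · simpa using mul_inv_cancel₀ hwi
    · intro j _ hj
      simp [Pi.single_eq_of_ne hj]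
    · simp
  · rintro _ ⟨e, he, rfl⟩
    rw [cForm_blockGram_re, inv_le_iff_one_le_mul₀' hC0]
    change ∑ i, w i * e i = 1 at he
    rw [Fin.sum_univ_three] at he
    set Q := s * (Complex.normSq (e 0) + Complex.normSq (e 1) + Complex.normSq (e 0 + e 1)) +
        t * Complex.normSq (e 2) with hQ
    have n0 := mul_nonneg hs.le (h0 (e 0))
    have n1 := mul_nonneg hs.le (h0 (e 1))
    have n2 := mul_nonneg hs.le (h0 (e 0 + e 1))
    have n3 := mul_nonneg ht.le (h0 (e 2))
    have b0 : Complex.normSq (e 0) ≤ Q / s := by rw [le_div_iff₀ hs]; linarith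
    have b1 : Complex.normSq (e 1) ≤ Q / s := by rw [le_div_iff₀ hs]; linarith
    have b2 : Complex.normSq (e 2) ≤ Q / t := by rw [le_div_iff₀ ht]; linarith
    have hnorm : 1 ≤ ‖w 0‖ * ‖e 0‖ + ‖w 1‖ * ‖e 1‖ + ‖w 2‖ * ‖e 2‖ := by
      have := norm_add₃_le (a := w 0 * e 0) (b := w 1 * e 1) (c := w 2 * e 2)
      rw [he] at this
      simpa using this
    have hsq : 1 ≤ 3 * (Complex.normSq (w 0) * Complex.normSq (e 0) +
        Complex.normSq (w 1) * Complex.normSq (e 1) +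
        Complex.normSq (w 2) * Complex.normSq (e 2)) := by
      simp only [Complex.normSq_eq_norm_sq]
      nlinarith [sq_nonneg (‖w 0‖ * ‖e 0‖ - ‖w 1‖ * ‖e 1‖),
        sq_nonneg (‖w 0‖ * ‖e 0‖ - ‖w 2‖ * ‖e 2‖), sq_nonneg (‖w 1‖ * ‖e 1‖ - ‖w 2‖ * ‖e 2‖)]
    have m0 := mul_le_mul_of_nonneg_left b0 (h0 (w 0))
    have m1 := mul_le_mul_of_nonneg_left b1 (h0 (w 1))
    have m2 := mul_le_mul_of_nonneg_left b2 (h0 (w 2))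
    have : C * Q = 3 * (Complex.normSq (w 0) * (Q / s) + Complex.normSq (w 1) * (Q / s) +
        Complex.normSq (w 2) * (Q / t)) := by rw [hC]; ring
    linarith

/-- The quotient metric is bounded by the one induced from the scaled `𝔸₂` block. -/
theorem quotMetric_blockGram_mul_le (hs : 0 < s) (hs' : s ≤ 2 / 3) (ht : 0 < t)
    (a b : ℂ) (ha : a = σ (ψ (Pi.single 0 1))) (hb : b = σ (ψ (Pi.single 1 1)))
    (hab : a ≠ 0 ∨ b ≠ 0) :
    quotMetric (fun _ => (blockGram s t).map Complex.ofReal) ψ σ *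
      ((Complex.normSq a + Complex.normSq b + Complex.normSq (a - b)) / 2) ≤ 1 := by
  set q : ℝ := (Complex.normSq a + Complex.normSq b + Complex.normSq (a - b)) / 2 with hq
  have h0 : ∀ z, 0 ≤ Complex.normSq z := Complex.normSq_nonneg
  have hq0 : 0 < q := by
    have := h0 a
    have := h0 b
    have := h0 (a - b)
    rcases hab with h | h
    · have := Complex.normSq_pos.2 h
      linarith
    · have := Complex.normSq_pos.2 h
      linarith
  have hqC : (q : ℂ) ≠ 0 := by exact_mod_cast hq0.ne'
  have key : a * (starRingEnd ℂ) (2 * a - b) + b * (starRingEnd ℂ) (2 * b - a) = 2 * q := by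
    apply Complex.ext
    · simp [hq, Complex.normSq_apply]
      ring
    · simp [hq]
      ring
  have h := quotMetric_blockGram_le s t ψ σ hs ht
    ![(starRingEnd ℂ) (2 * a - b) / (2 * q), (starRingEnd ℂ) (2 * b - a) / (2 * q), 0] (by
      rw [Fin.sum_univ_three, ← ha, ← hb]
      simp only [Matrix.cons_val, mul_zero, add_zero]
      rw [← mul_div_assoc, ← mul_div_assoc, ← add_div, key, div_self]
      simpa using hqC)
  have hval : Complex.normSq ((starRingEnd ℂ) (2 * a - b) / (2 * q)) +
      Complex.normSq ((starRingEnd ℂ) (2 * b - a) / (2 * q)) +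
      Complex.normSq ((starRingEnd ℂ) (2 * a - b) / (2 * q) +
        (starRingEnd ℂ) (2 * b - a) / (2 * q)) = 3 / 2 / q := by
    rw [← add_div, ← map_add (starRingEnd ℂ)]
    simp only [map_div₀, Complex.normSq_conj, map_mul, Complex.normSq_ofReal]
    have : Complex.normSq (2 * a - b) + Complex.normSq (2 * b - a) +
        Complex.normSq (2 * a - b + (2 * b - a)) = 6 * q := by
      simp [hq, Complex.normSq_apply]
      ring
    rw [← add_div, ← add_div, this]
    have : Complex.normSq 2 = 4 := by norm_num [Complex.normSq_apply]
    rw [this]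
    field_simp
    norm_num
  simp only [Matrix.cons_val, map_zero, mul_zero, add_zero] at h
  rw [hval] at h
  calc _ ≤ s * (3 / 2 / q) * q := by gcongr
    _ = s * (3 / 2) := by field_simp
    _ ≤ 1 := by linarith

theorem quotMetric_blockGram_mul_normSq_le (hs : 0 < s) (ht : 0 < t) (ht' : t ≤ 1)
    (hc : ψ (Pi.single 2 1) ≠ 0) :
    quotMetric (fun _ => (blockGram s t).map Complex.ofReal) ψ σ *
      Complex.normSq (σ (ψ (Pi.single 2 1))) ≤ 1 := by
  set c := σ (ψ (Pi.single 2 1)) with hcd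
  have hc' : c ≠ 0 := by simpa [hcd] using hc
  have hp := Complex.normSq_pos.2 hc'
  have h := quotMetric_blockGram_le s t ψ σ hs ht ![0, 0, c⁻¹] (by
    rw [Fin.sum_univ_three, ← hcd]
    simpa using mul_inv_cancel₀ hc')
  simp only [Matrix.cons_val, map_zero, mul_zero, add_zero, zero_add, map_inv₀] at h
  calc _ ≤ t * (Complex.normSq c)⁻¹ * Complex.normSq c := by gcongr
    _ = t := by field_simp
    _ ≤ 1 := ht'

end quotMetric

theorem mul_mul_le_half_add_cubed {u v w : ℝ} (hu : 0 ≤ u) (hv : 0 ≤ v) (hw : 0 ≤ w) :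
    u * v * w ≤ ((u + v + w) / 2) ^ 3 := by
  nlinarith [mul_nonneg hu (sq_nonneg (v - w)), mul_nonneg hv (sq_nonneg (u - w)),
    mul_nonneg hw (sq_nonneg (u - v)), pow_nonneg hu 3, pow_nonneg hv 3, pow_nonneg hw 3,
    mul_nonneg (mul_nonneg hu hv) hw]

theorem exists_integer_denominator {K : Type} [Field K] [NumberField K]
    (E : Submodule (𝓞 ℚ) (Fin 3 → ℚ))
    (hE : E = Submodule.span (𝓞 ℚ) (Set.range fun i : Fin 3 => (Pi.single i 1 : Fin 3 → ℚ)))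
    [Algebra ℚ K] (ψ : (Fin 3 → K) →ₗ[K] K) :
    ∃ d : 𝓞 K, d ≠ 0 ∧ ∀ l ∈ Submodule.map (ψ.restrictScalars (𝓞 K)) (baseChange ℚ K E),
      ∃ z : 𝓞 K, (z : K) = d * l := by
  obtain ⟨d, hd⟩ := IsLocalization.exist_integer_multiples_of_finite (nonZeroDivisors (𝓞 K))
    fun i : Fin 3 => ψ (Pi.single i 1)
  refine ⟨d, nonZeroDivisors.ne_zero d.2, ?_⟩
  let N : Submodule (𝓞 K) (Fin 3 → K) := Submodule.comap
    ((LinearMap.mulLeft (𝓞 K) ((d : 𝓞 K) : K)).comp (ψ.restrictScalars (𝓞 K)))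
    (LinearMap.range (Algebra.linearMap (𝓞 K) K))
  have hsingle : ∀ i, (Pi.single i 1 : Fin 3 → K) ∈ N := fun i => by
    obtain ⟨z, hz⟩ := hd i
    refine ⟨z, ?_⟩
    simpa [Algebra.smul_def, Submonoid.smul_def] using hz
  have hN : baseChange ℚ K E ≤ N := by
    refine Submodule.span_le.2 ?_
    rintro _ ⟨v, hv, rfl⟩
    have hv' : ∃ z : Fin 3 → ℤ, v = fun i => (z i : ℚ) := by
      rw [SetLike.mem_coe, hE] at hv
      induction hv using Submodule.span_induction with
      | mem x hx =>
        obtain ⟨i, rfl⟩ := hx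
        exact ⟨Pi.single i 1, by ext j; simp [Pi.single_apply]⟩
      | zero => exact ⟨0, by ext; simp⟩
      | add x y _ _ hx hy =>
        obtain ⟨a, rfl⟩ := hx
        obtain ⟨b, rfl⟩ := hy
        exact ⟨a + b, by ext; simp⟩
      | smul r x _ hx =>
        obtain ⟨a, rfl⟩ := hx
        refine ⟨fun i => Rat.ringOfIntegersEquiv r * a i, ?_⟩
        ext i
        simp [Rat.ringOfIntegersEquiv_apply_coe, Algebra.smul_def]
    obtain ⟨z, rfl⟩ := hv'
    have : (fun i => algebraMap ℚ K (z i)) = ∑ i, (z i) • (Pi.single i 1 : Fin 3 → K) := by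
      ext j
      simp [Pi.single_apply]
    rw [SetLike.mem_coe]
    simp only [this]
    exact sum_mem fun i _ => zsmul_mem (hsingle i) _
  rintro _ ⟨w, hw, rfl⟩
  obtain ⟨z, hz⟩ := hN hw
  exact ⟨z, hz⟩

theorem isNef_blockGram (s t : ℝ) (hs : 0 < s) (hs' : s ≤ 2 / 3) (ht : 0 < t) (ht' : t ≤ 1)
    (E : Submodule (𝓞 ℚ) (Fin 3 → ℚ))
    (hE : E = Submodule.span (𝓞 ℚ) (Set.range fun i : Fin 3 => (Pi.single i 1 : Fin 3 → ℚ))) :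
    IsNef ℚ (fun _ => (blockGram s t).map Complex.ofReal) E := by
  intro K _ _ _ ψ hL
  set L := Submodule.map (ψ.restrictScalars (𝓞 K)) (baseChange ℚ K E) with hLd
  obtain ⟨d, hd, hdL⟩ := exists_integer_denominator E hE ψ
  have hmem : ∀ i, ψ (Pi.single i 1) ∈ L := fun i => by
    refine ⟨Pi.single i 1, Submodule.subset_span ⟨Pi.single i 1, ?_, ?_⟩, rfl⟩
    · rw [hE]
      exact Submodule.subset_span ⟨i, rfl⟩
    · ext j
      simp [Pi.single_apply]
  have hex : ∃ i, ψ (Pi.single i 1) ≠ 0 := by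
    by_contra! h
    apply hL
    have : ψ = 0 := LinearMap.pi_ext' fun i => LinearMap.ext_ring (by simpa using h i)
    rw [hLd, this]
    ext
    simp
  obtain ⟨i, hi⟩ := hex
  change 0 ≤ degLine K L (quotMetric (fun _ => (blockGram s t).map Complex.ofReal) ψ)
  have hpos := fun σ => quotMetric_blockGram_pos s t ψ σ hs ht i hi
  have hsingle : ∀ y ∈ L, y ≠ 0 → (∀ σ, quotMetric (fun _ => (blockGram s t).map Complex.ofReal)
      ψ σ * Complex.normSq (σ y) ≤ 1) →
      0 ≤ degLine K L (quotMetric (fun _ => (blockGram s t).map Complex.ofReal) ψ) :=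
    fun y hy hy0 h => degLine_nonneg K L _ d hd hdL (fun _ => y) (fun _ => hy) (fun _ => hy0) hpos
      fun σ => by
        rw [Finset.prod_const, Finset.card_univ, Fintype.card_fin, ← mul_pow]
        exact pow_le_one₀ (mul_nonneg (hpos σ).le (Complex.normSq_nonneg _)) (h σ)
  set a := ψ (Pi.single 0 1) with ha
  set b := ψ (Pi.single 1 1) with hb
  have hA : a ≠ 0 ∨ b ≠ 0 → ∀ σ : K →+* ℂ,
      quotMetric (fun _ => (blockGram s t).map Complex.ofReal) ψ σ *
      ((Complex.normSq (σ a) + Complex.normSq (σ b) + Complex.normSq (σ (a - b))) / 2) ≤ 1 :=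
    fun h σ => by
      rw [map_sub]
      exact quotMetric_blockGram_mul_le s t ψ σ hs hs' ht _ _ rfl rfl (by simpa using h)
  by_cases ha0 : a = 0
  · by_cases hb0 : b = 0
    · have hc0 : ψ (Pi.single 2 1) ≠ 0 := by
        fin_cases i
        · exact absurd ha0 hi
        · exact absurd hb0 hi
        · exact hi
      exact hsingle _ (hmem 2) hc0 fun σ =>
        quotMetric_blockGram_mul_normSq_le s t ψ σ hs ht ht' hc0
    · refine hsingle b (hmem 1) hb0 fun σ => ?_
      simpa [ha0] using hA (Or.inr hb0) σ
  · by_cases hb0 : b = 0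
    · refine hsingle a (hmem 0) ha0 fun σ => ?_
      simpa [hb0] using hA (Or.inl ha0) σ
    · by_cases hab : a - b = 0
      · refine hsingle a (hmem 0) ha0 fun σ => ?_
        simpa [← sub_eq_zero.1 hab] using hA (Or.inl ha0) σ
      · refine degLine_nonneg K L _ d hd hdL ![a, b, a - b] ?_ ?_ hpos fun σ => ?_
        · intro i
          fin_cases i
          · exact hmem 0
          · exact hmem 1
          · exact sub_mem (hmem 0) (hmem 1)
        · intro i
          fin_cases i
          · exact ha0
          · exact hb0
          · exact hab
        · rw [Fin.prod_univ_three]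
          simp only [Matrix.cons_val]
          have h0 : ∀ z, 0 ≤ Complex.normSq z := Complex.normSq_nonneg
          have hσ := hpos σ
          calc _ ≤ _ := mul_le_mul_of_nonneg_left
                (mul_mul_le_half_add_cubed (h0 (σ a)) (h0 (σ b)) (h0 (σ (a - b))))
                (pow_pos hσ 3).le
            _ ≤ 1 := by
              rw [← mul_pow]
              refine pow_le_one₀ (mul_nonneg hσ.le ?_) (hA (Or.inl ha0) σ)
              have := h0 (σ a)
              have := h0 (σ b)
              have := h0 (σ (a - b))
              positivity

/-- The Gram determinant of a family of rational vectors for the bilinear form with matrix `G`. -/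
def gramDet {ι : Type} [Fintype ι] (G : Matrix ι ι ℝ) {r : ℕ} (f : Fin r → ι → ℚ) : ℝ :=
  ((Matrix.of f).map (Rat.cast : ℚ → ℝ) * G * ((Matrix.of f).map (Rat.cast : ℚ → ℝ)).transpose).det

theorem gramDet_pos {ι : Type} [Fintype ι] {G : Matrix ι ι ℝ} (hG : G.PosDef) {r : ℕ}
    {f : Fin r → ι → ℚ} (hf : LinearIndependent ℚ f) : 0 < gramDet G f := by
  have hli : LinearIndependent ℝ (fun a => algebraMap ℚ ℝ ∘ f a) :=
    (linearIndependent_algebraMap_comp_iff (R := ℚ) (S := ℝ)).2 hf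
  have hP : (((Matrix.of f).map (Rat.cast : ℚ → ℝ)) * G *
      ((Matrix.of f).map (Rat.cast : ℚ → ℝ)).conjTranspose).PosDef :=
    hG.mul_mul_conjTranspose_same (Matrix.vecMul_injective_iff.2 hli)
  rw [gramDet, ← Matrix.conjTranspose_eq_transpose_of_trivial]
  exact hP.det_pos

theorem det_eForm_re {ι : Type} [Fintype ι] (G : Matrix ι ι ℝ) {r : ℕ} (f : Fin r → ι → ℚ)
    (σ : ℚ →+* ℂ) :
    (Matrix.of fun a b => eForm (G.map Complex.ofReal) σ (f a) (f b)).det.re = gramDet G f := by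
  have : (Matrix.of fun a b => eForm (G.map Complex.ofReal) σ (f a) (f b)) =
      Complex.ofRealHom.mapMatrix ((Matrix.of f).map (Rat.cast : ℚ → ℝ) * G *
        ((Matrix.of f).map (Rat.cast : ℚ → ℝ)).transpose) := by
    ext a b
    simp only [eForm, cForm, Matrix.of_apply, RingHom.mapMatrix_apply, Matrix.map_apply,
      Matrix.mul_apply, Matrix.transpose_apply, Complex.ofRealHom_eq_coe, Complex.ofReal_sum,
      Complex.ofReal_mul, Finset.sum_mul, eq_ratCast, map_ratCast, Complex.ofReal_ratCast]
    exact Finset.sum_comm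
  rw [this, ← RingHom.map_det]
  rfl

theorem surjective_algebraMap_int_ringOfIntegers_rat :
    Function.Surjective (algebraMap ℤ (𝓞 ℚ)) := fun z =>
  ⟨Rat.ringOfIntegersEquiv z, by
    apply Rat.ringOfIntegersEquiv.injective
    simp⟩

/-- The degree of a submodule of `ℚ^ι` in terms of the Gram determinant of a `ℤ`-basis. -/
theorem hDeg_eq_log_gramDet {ι : Type} [Fintype ι] {G : Matrix ι ι ℝ} (hG : G.PosDef) {r : ℕ}
    (hr : 0 < r) {f : Fin r → ι → ℚ} (hf : LinearIndependent ℚ f)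
    (F : Submodule (𝓞 ℚ) (ι → ℚ))
    (hF : F.restrictScalars ℤ = Submodule.span ℤ (Set.range f)) :
    hDeg ℚ (fun _ => G.map Complex.ofReal) F = -(Real.log (gramDet G f) / 2) := by
  have hfF : ∀ a, f a ∈ F := fun a => by
    have : f a ∈ F.restrictScalars ℤ := hF ▸ Submodule.subset_span ⟨a, rfl⟩
    exact this
  have hFf : ∀ y ∈ F, y ∈ Submodule.span ℚ (Set.range f) := fun y hy => by
    have : y ∈ Submodule.span ℤ (Set.range f) := hF ▸ hy
    exact Submodule.span_subset_span ℤ ℚ _ this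
  have h : ∃ p : (s : ℕ) × (Fin s → ι → ℚ), 0 < p.1 ∧ (∀ a, p.2 a ∈ F) ∧
      LinearIndependent ℚ p.2 ∧ ∀ y ∈ F, y ∈ Submodule.span ℚ (Set.range p.2) :=
    ⟨⟨r, f⟩, hr, hfF, hf, hFf⟩
  rw [hDeg, dif_pos h]
  obtain ⟨-, hxF, hx, hFx⟩ := h.choose_spec
  generalize h.choose = p at hxF hx hFx
  obtain ⟨s, x⟩ := p
  dsimp only at hxF hx hFx ⊢
  obtain rfl : s = r := by
    have hspan : Submodule.span ℚ (Set.range x) = Submodule.span ℚ (Set.range f) :=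
      le_antisymm (Submodule.span_le.2 (Set.range_subset_iff.2 fun a => hFf _ (hxF a)))
        (Submodule.span_le.2 (Set.range_subset_iff.2 fun a => hFx _ (hfF a)))
    have h1 := finrank_span_eq_card hx
    rw [hspan, finrank_span_eq_card hf] at h1
    simpa using h1.symm
  simp only [det_eForm_re]
  rw [finsum_eq_single _ (algebraMap ℚ ℂ) fun σ hσ => absurd (Subsingleton.elim _ _) hσ]
  have hLI : ∀ {y : Fin s → ι → ℚ} (hy : ∀ a, y a ∈ F), LinearIndependent ℚ y →
      LinearIndependent ℤ (fun a => (⟨y a, hy a⟩ : F)) := fun hy h =>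
    LinearIndependent.of_comp (F.subtype.restrictScalars ℤ) (h.restrict_scalars' ℤ)
  let b : Module.Basis (Fin s) ℤ F := Module.Basis.mk (hLI hfF hf) (by
    rintro ⟨y, hy⟩ -
    have hy' : y ∈ Submodule.span ℤ (Set.range f) := hF ▸ hy
    rw [Submodule.mem_span_range_iff_exists_fun] at hy' ⊢
    obtain ⟨c, hc⟩ := hy'
    exact ⟨c, Subtype.ext (by simpa using hc)⟩)
  let N : Submodule ℤ F := (Submodule.comap F.subtype
    (Submodule.span (𝓞 ℚ) (Set.range x))).restrictScalars ℤ
  have hxN : ∀ a, (⟨x a, hxF a⟩ : F) ∈ N := fun a => by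
    change x a ∈ Submodule.span (𝓞 ℚ) (Set.range x)
    exact Submodule.subset_span ⟨a, rfl⟩
  let bN : Module.Basis (Fin s) ℤ N := Module.Basis.mk
    (v := fun a => (⟨⟨x a, hxF a⟩, hxN a⟩ : N))
    (LinearIndependent.of_comp N.subtype (hLI hxF hx)) (by
    rintro ⟨⟨y, hy⟩, hyN⟩ -
    have hy' : y ∈ (Submodule.span (𝓞 ℚ) (Set.range x)).restrictScalars ℤ := hyN
    rw [Submodule.restrictScalars_span _ _ surjective_algebraMap_int_ringOfIntegers_rat] at hy'
    rw [Submodule.mem_span_range_iff_exists_fun] at hy' ⊢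
    obtain ⟨c, hc⟩ := hy'
    exact ⟨c, Subtype.ext (Subtype.ext (by simpa using hc))⟩)
  have := Module.Free.of_basis b
  have := Module.Finite.of_basis b
  have hcard := Submodule.natAbs_det_basis_change b N bN
  set A := b.toMatrix (fun a => (⟨x a, hxF a⟩ : F)) with hA
  have hdet : b.det (Subtype.val ∘ bN) = A.det := by
    rw [Module.Basis.det_apply, hA]
    congr 2
    ext a : 1
    simp [bN]
  have hxA : ∀ a, x a = ∑ i, A i a • f i := fun a => by
    have h1 := congrArg F.subtype (b.sum_toMatrix_smul_self (fun a => (⟨x a, hxF a⟩ : F)) a)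
    simpa [b] using h1.symm
  have hgram : gramDet G x = (A.det : ℝ) ^ 2 * gramDet G f := by
    have hmat : (Matrix.of x).map (Rat.cast : ℚ → ℝ) =
        ((Int.castRingHom ℝ).mapMatrix A).transpose * (Matrix.of f).map (Rat.cast : ℚ → ℝ) := by
      ext a j
      simp [hxA a, Matrix.mul_apply]
    have hdA : ((Int.castRingHom ℝ).mapMatrix A).det = A.det := by
      rw [← RingHom.map_det]
      simp
    rw [gramDet, gramDet, hmat]
    generalize (Matrix.of f).map (Rat.cast : ℚ → ℝ) = P
    generalize (Int.castRingHom ℝ).mapMatrix A = B at hdA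
    have hassoc : B.transpose * P * G * (B.transpose * P).transpose =
        B.transpose * (P * G * P.transpose) * B := by
      simp only [Matrix.transpose_mul, Matrix.transpose_transpose, Matrix.mul_assoc]
    rw [hassoc, Matrix.det_mul, Matrix.det_mul, Matrix.det_transpose, hdA]
    ring
  have hgx := gramDet_pos hG hx
  have hgf := gramDet_pos hG hf
  have hA0 : (A.det : ℝ) ≠ 0 := fun h0 => by simp [hgram, h0] at hgx
  have hcard' : Nat.card (F ⧸ Submodule.comap F.subtype (Submodule.span (𝓞 ℚ) (Set.range x))) =
      A.det.natAbs := by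
    rw [← hdet, hcard]
    rfl
  rw [hcard', Real.log_sqrt hgx.le, hgram, Real.log_mul (by positivity) hgf.ne', Real.log_pow,
    Nat.cast_natAbs, Int.cast_abs, Real.log_abs]
  push_cast
  ring

theorem blockGram_posDef {s t : ℝ} (hs : 0 < s) (ht : 0 < t) : (blockGram s t).PosDef := by
  refine Matrix.PosDef.of_dotProduct_mulVec_pos ?_ fun v hv => ?_
  · ext i j
    fin_cases i <;> fin_cases j <;> simp [blockGram]
  · have hval : star v ⬝ᵥ (blockGram s t).mulVec v =
        s * (v 0 ^ 2 + v 1 ^ 2 + (v 0 + v 1) ^ 2) + t * v 2 ^ 2 := by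
      simp [blockGram, dotProduct, Matrix.mulVec, Fin.sum_univ_three]
      ring
    rw [hval]
    obtain ⟨i, hi⟩ := Function.ne_iff.1 hv
    have hi' : v i ≠ 0 := hi
    fin_cases i
    · have : v 0 ≠ 0 := hi'
      positivity
    · have : v 1 ≠ 0 := hi'
      positivity
    · have : v 2 ≠ 0 := hi'
      positivity

theorem le_combination_of_pos {c α β : ℝ} (hα : 0 ≤ α) (hβ : 0 ≤ β) (hcα : c ≤ α) (hcβ : c ≤ β)
    {m n : ℤ} (hm : 0 ≤ m) (hn : 0 ≤ n) (h : 0 < α * m + β * n) : c ≤ α * m + β * n := by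
  have hm' : (0 : ℝ) ≤ m := by exact_mod_cast hm
  have hn' : (0 : ℝ) ≤ n := by exact_mod_cast hn
  rcases hm.eq_or_lt with rfl | hm1
  · rcases hn.eq_or_lt with rfl | hn1
    · simp at h
    · have : (1 : ℝ) ≤ n := by exact_mod_cast hn1
      nlinarith
  · have : (1 : ℝ) ≤ m := by exact_mod_cast hm1
    nlinarith [mul_nonneg hβ hn']

/-- Gram determinants of linearly independent integral families are bounded below. -/
theorem le_gramDet_blockGram {s t c : ℝ} (hs : 0 < s) (ht : 0 < t) (h1 : c ≤ s) (h2 : c ≤ t)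
    (h3 : c ≤ 3 * s ^ 2) (h4 : c ≤ s * t) (h5 : c ≤ 3 * s ^ 2 * t) {r : ℕ} (hr : 0 < r)
    (hr3 : r ≤ 3) (z : Fin r → Fin 3 → ℤ)
    (hz : LinearIndependent ℚ (fun a i => (z a i : ℚ))) :
    c ≤ gramDet (blockGram s t) (fun a i => (z a i : ℚ)) := by
  have hpos := gramDet_pos (blockGram_posDef hs ht) hz
  interval_cases r
  · have key : gramDet (blockGram s t) (fun a i => (z a i : ℚ)) =
        s * (z 0 0 ^ 2 + z 0 1 ^ 2 + (z 0 0 + z 0 1) ^ 2 : ℤ) + t * (z 0 2 ^ 2 : ℤ) := by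
      simp [gramDet, blockGram, Matrix.mul_apply, Fin.sum_univ_three]
      ring
    rw [key] at hpos ⊢
    exact le_combination_of_pos hs.le ht.le h1 h2 (by positivity) (by positivity) hpos
  · have key : gramDet (blockGram s t) (fun a i => (z a i : ℚ)) =
        3 * s ^ 2 * ((z 0 0 * z 1 1 - z 0 1 * z 1 0) ^ 2 : ℤ) +
        s * t * ((z 0 0 * z 1 2 - z 0 2 * z 1 0) ^ 2 + (z 0 1 * z 1 2 - z 0 2 * z 1 1) ^ 2 +
          (z 0 0 * z 1 2 - z 0 2 * z 1 0 + (z 0 1 * z 1 2 - z 0 2 * z 1 1)) ^ 2 : ℤ) := by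
      simp [gramDet, blockGram, Matrix.mul_apply, Fin.sum_univ_three, Matrix.det_fin_two]
      ring
    rw [key] at hpos ⊢
    exact le_combination_of_pos (by positivity) (by positivity) h3 h4 (by positivity)
      (by positivity) hpos
  · have key : gramDet (blockGram s t) (fun a i => (z a i : ℚ)) =
        3 * s ^ 2 * t * ((Matrix.of z).det ^ 2 : ℤ) + 3 * s ^ 2 * t * (0 : ℤ) := by
      have hP : (Matrix.of fun a i => (z a i : ℚ)).map (Rat.cast : ℚ → ℝ) =
          (Int.castRingHom ℝ).mapMatrix (Matrix.of z) := by
        ext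
        simp
      have hH : (blockGram s t).det = 3 * s ^ 2 * t := by
        simp [blockGram, Matrix.det_fin_three]
        ring
      rw [gramDet, hP, Matrix.det_mul, Matrix.det_mul, Matrix.det_transpose, ← RingHom.map_det, hH]
      simp
      ring
    rw [key] at hpos ⊢
    exact le_combination_of_pos (by positivity) (by positivity) h5 h5 (by positivity) le_rfl hpos

theorem exists_int_basis (F : Submodule (𝓞 ℚ) (Fin 3 → ℚ)) (hF : F ≠ ⊥)
    (hFE : F ≤ Submodule.span (𝓞 ℚ)
      (Set.range fun i : Fin 3 => (Pi.single i 1 : Fin 3 → ℚ))) :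
    ∃ (r : ℕ) (z : Fin r → Fin 3 → ℤ), 0 < r ∧ r ≤ 3 ∧
      LinearIndependent ℚ (fun a i => (z a i : ℚ)) ∧
      F.restrictScalars ℤ = Submodule.span ℤ (Set.range fun a i => (z a i : ℚ)) := by
  let φ : (Fin 3 → ℤ) →ₗ[ℤ] (Fin 3 → ℚ) := (Algebra.linearMap ℤ ℚ).compLeft (Fin 3)
  obtain ⟨r, b⟩ := Submodule.basisOfPid (Pi.basisFun ℤ (Fin 3)) ((F.restrictScalars ℤ).comap φ)
  have hbli : LinearIndependent ℤ (fun a => (b a : Fin 3 → ℤ)) :=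
    b.linearIndependent.map' (Submodule.subtype _) (Submodule.ker_subtype _)
  have hspan : F.restrictScalars ℤ =
      Submodule.span ℤ (Set.range fun a i => ((b a : Fin 3 → ℤ) i : ℚ)) := by
    have h1 : F.restrictScalars ℤ = ((F.restrictScalars ℤ).comap φ).map φ := by
      refine (Submodule.map_comap_eq_of_le ?_).symm
      intro y hy
      have hy' : y ∈ (Submodule.span (𝓞 ℚ)
        (Set.range fun i : Fin 3 => (Pi.single i 1 : Fin 3 → ℚ))).restrictScalars ℤ := hFE hy
      rw [Submodule.restrictScalars_span _ _ surjective_algebraMap_int_ringOfIntegers_rat] at hy'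
      refine Submodule.span_le.2 ?_ hy'
      rintro _ ⟨i, rfl⟩
      refine ⟨Pi.single i 1, ?_⟩
      ext j
      simp [φ, Pi.single_apply]
    have h2 : (F.restrictScalars ℤ).comap φ =
        Submodule.span ℤ (Set.range fun a => (b a : Fin 3 → ℤ)) := by
      have := congrArg (Submodule.map (Submodule.subtype _)) b.span_eq
      rw [Submodule.map_span, Submodule.map_top, Submodule.range_subtype, ← Set.range_comp] at this
      exact this.symm
    rw [h2, Submodule.map_span, ← Set.range_comp] at h1
    refine h1.trans ?_
    congr 2
  refine ⟨r, fun a => b a, ?_, ?_, ?_, hspan⟩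
  · rw [Nat.pos_iff_ne_zero]
    rintro rfl
    apply hF
    rw [Set.range_eq_empty, Submodule.span_empty] at hspan
    exact (Submodule.restrictScalars_eq_bot_iff ..).1 hspan
  · have := hbli.fintype_card_le_finrank
    rwa [Fintype.card_fin, Module.finrank_fin_fun] at this
  · exact (linearIndependent_algebraMap_comp_iff (R := ℤ) (S := ℚ)).2 hbli

theorem bddAbove_slopes_blockGram {s t : ℝ} (hs : 0 < s) (ht : 0 < t)
    (E : Submodule (𝓞 ℚ) (Fin 3 → ℚ))
    (hE : E = Submodule.span (𝓞 ℚ) (Set.range fun i : Fin 3 => (Pi.single i 1 : Fin 3 → ℚ))) :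
    BddAbove { m : ℝ | ∃ F : Submodule (𝓞 ℚ) (Fin 3 → ℚ), F ≠ ⊥ ∧ F ≤ E ∧
      m = hMu ℚ (fun _ => (blockGram s t).map Complex.ofReal) F } := by
  obtain ⟨c, hc, h1, h2, h3, h4, h5⟩ : ∃ c : ℝ, 0 < c ∧ c ≤ s ∧ c ≤ t ∧ c ≤ 3 * s ^ 2 ∧
      c ≤ s * t ∧ c ≤ 3 * s ^ 2 * t :=
    ⟨min s (min t (min (3 * s ^ 2) (min (s * t) (3 * s ^ 2 * t)))), by positivity,
      by simp, by simp, by simp, by simp, by simp⟩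
  refine ⟨max (-(Real.log c / 2)) 0, ?_⟩
  rintro _ ⟨F, hF, hFE, rfl⟩
  obtain ⟨r, z, hr, hr3, hz, hFz⟩ := exists_int_basis F hF (hE ▸ hFE)
  have hdeg := hDeg_eq_log_gramDet (blockGram_posDef hs ht) hr hz F hFz
  have hlog := Real.log_le_log hc (le_gramDet_blockGram hs ht h1 h2 h3 h4 h5 hr hr3 z hz)
  have hle : hDeg ℚ (fun _ => (blockGram s t).map Complex.ofReal) F ≤
      max (-(Real.log c / 2)) 0 := by
    rw [hdeg]
    exact le_max_of_le_left (by linarith)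
  have h0 : 0 ≤ max (-(Real.log c / 2)) 0 := le_max_right _ _
  rw [hMu]
  rcases Nat.eq_zero_or_pos (hRank ℚ F) with h | h
  · simp [h]
  · have : (1 : ℝ) ≤ hRank ℚ F := by exact_mod_cast h
    rw [div_le_iff₀ (by linarith)]
    nlinarith

theorem hDeg_blockGram_standard {s t : ℝ} (hs : 0 < s) (ht : 0 < t) :
    hDeg ℚ (fun _ => (blockGram s t).map Complex.ofReal)
      (Submodule.span (𝓞 ℚ) (Set.range fun i : Fin 3 => (Pi.single i 1 : Fin 3 → ℚ))) =
      -(Real.log (3 * s ^ 2 * t) / 2) := by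
  rw [hDeg_eq_log_gramDet (blockGram_posDef hs ht) (by norm_num)
    (f := fun i : Fin 3 => (Pi.single i 1 : Fin 3 → ℚ)) ?_ _
    (Submodule.restrictScalars_span _ _ surjective_algebraMap_int_ringOfIntegers_rat _)]
  · congr 3
    have : (Matrix.of fun i : Fin 3 => (Pi.single i 1 : Fin 3 → ℚ)).map (Rat.cast : ℚ → ℝ) = 1 := by
      ext i j
      by_cases h : i = j
      · subst h
        simp
      · simp [h]
    rw [gramDet, this]
    simp [blockGram, Matrix.det_fin_three]
    ring
  · exact Pi.linearIndependent_single_one (Fin 3) ℚ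

theorem hDeg_blockGram_last {s t : ℝ} (hs : 0 < s) (ht : 0 < t) :
    hDeg ℚ (fun _ => (blockGram s t).map Complex.ofReal)
      (Submodule.span (𝓞 ℚ) {(Pi.single 2 1 : Fin 3 → ℚ)}) = -(Real.log t / 2) := by
  rw [hDeg_eq_log_gramDet (blockGram_posDef hs ht) one_pos
    (f := fun _ => (Pi.single 2 1 : Fin 3 → ℚ)) ?_ _ ?_]
  · congr 3
    simp [gramDet, blockGram, Matrix.mul_apply, Fin.sum_univ_three]
  · exact LinearIndependent.of_subsingleton 0 (by simp)
  · rw [Set.range_const]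
    exact Submodule.restrictScalars_span _ _ surjective_algebraMap_int_ringOfIntegers_rat _

theorem not_semistable_blockGram {s t : ℝ} (hs : 0 < s) (ht : 0 < t) (ht' : t < 1)
    (E : Submodule (𝓞 ℚ) (Fin 3 → ℚ))
    (hE : E = Submodule.span (𝓞 ℚ) (Set.range fun i : Fin 3 => (Pi.single i 1 : Fin 3 → ℚ)))
    (hdeg : hDeg ℚ (fun _ => (blockGram s t).map Complex.ofReal) E = 0) :
    hMuMax ℚ (fun _ => (blockGram s t).map Complex.ofReal) E ≠
      hMu ℚ (fun _ => (blockGram s t).map Complex.ofReal) E := by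
  have hmu : hMu ℚ (fun _ => (blockGram s t).map Complex.ofReal) E = 0 := by
    rw [hMu, hdeg, zero_div]
  rw [hmu]
  set F := Submodule.span (𝓞 ℚ) {(Pi.single 2 1 : Fin 3 → ℚ)} with hF
  have hmem : (Pi.single 2 1 : Fin 3 → ℚ) ∈ F := Submodule.mem_span_singleton_self _
  have hF0 : F ≠ ⊥ := by
    rw [hF, Ne, Submodule.span_singleton_eq_bot]
    simp
  have hrank : 0 < hRank ℚ F := by
    rw [hRank, Module.finrank_pos_iff, Submodule.nontrivial_iff_ne_bot]
    intro h
    have := Submodule.span_eq_bot.1 h _ hmem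
    simp at this
  have hpos : 0 < hMu ℚ (fun _ => (blockGram s t).map Complex.ofReal) F := by
    rw [hMu, hF, hDeg_blockGram_last hs ht, ← hF]
    have := Real.log_neg ht ht'
    exact div_pos (by linarith) (by exact_mod_cast hrank)
  refine (lt_of_lt_of_le hpos (le_csSup (bddAbove_slopes_blockGram hs ht E hE)
    ⟨F, hF0, ?_, rfl⟩)).ne'
  rw [hF, hE]
  exact Submodule.span_mono (by simp)


/-- Let `𝔸₂` be the euclidean lattice of rank 2 with Gram matrix
`[[2,1],[1,2]]` and fix `λ ∈ [½·log(3/2), ¼·log 3)`.  Then the orthogonal sum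
`𝔸₂⟨λ⟩ ⊥ ℤ̄⟨½·log 3 - 2λ⟩` — the standard lattice `𝒪_ℚ³ ⊆ ℚ³` with the block-diagonal
metric scaling the `𝔸₂`-block by `e^{-2λ}` and the unit rank-one block by
`e^{-2(½·log 3 - 2λ)}` — is a nef euclidean lattice of degree `0` which is not semistable
(i.e. `μ_max ≠ μ`).  In particular a nef hermitian lattice of degree zero need not be
semistable. -/
theorem nef_degree_zero_not_semistable (lam : ℝ)
    (hlam : (1 / 2) * Real.log (3 / 2) ≤ lam ∧ lam < Real.log 3 / 4)
    (E : Submodule (𝓞 ℚ) (Fin 3 → ℚ))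
    (hE : E = Submodule.span (𝓞 ℚ) (Set.range fun i : Fin 3 => (Pi.single i 1 : Fin 3 → ℚ)))
    (H : (ℚ →+* ℂ) → Matrix (Fin 3) (Fin 3) ℂ)
    (hH : H = fun _ =>
      !![2 * (Real.exp (-(2 * lam)) : ℂ), (Real.exp (-(2 * lam)) : ℂ), 0;
         (Real.exp (-(2 * lam)) : ℂ), 2 * (Real.exp (-(2 * lam)) : ℂ), 0;
         0, 0, (Real.exp (-(2 * (Real.log 3 / 2 - 2 * lam))) : ℂ)]) :
    IsNef ℚ H E ∧ hDeg ℚ H E = 0 ∧ hMuMax ℚ H E ≠ hMu ℚ H E := by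
  set s := Real.exp (-(2 * lam)) with hs
  set t := Real.exp (-(2 * (Real.log 3 / 2 - 2 * lam))) with ht
  have hs0 : 0 < s := Real.exp_pos _
  have ht0 : 0 < t := Real.exp_pos _
  have hs1 : s ≤ 2 / 3 := by
    rw [hs, ← Real.le_log_iff_exp_le (by norm_num), show (2 / 3 : ℝ) = (3 / 2)⁻¹ by norm_num,
      Real.log_inv]
    linarith
  have ht1 : t < 1 := by
    rw [ht, Real.exp_lt_one_iff]
    linarith
  have hst : 3 * s ^ 2 * t = 1 := by
    nth_rewrite 1 [← Real.exp_log (show (0 : ℝ) < 3 by norm_num)]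
    rw [hs, ht, ← Real.exp_nat_mul, ← Real.exp_add, ← Real.exp_add, Real.exp_eq_one_iff]
    push_cast
    ring
  have hH' : H = fun _ => (blockGram s t).map Complex.ofReal := by
    rw [hH]
    ext σ i j
    fin_cases i <;> fin_cases j <;> simp [blockGram]
  have hdeg : hDeg ℚ (fun _ => (blockGram s t).map Complex.ofReal) E = 0 := by
    rw [hE, hDeg_blockGram_standard hs0 ht0, hst]
    simp
  rw [hH']
  exact ⟨isNef_blockGram s t hs0 hs1 ht0 ht1.le E hE, hdeg,
    not_semistable_blockGram hs0 ht0 ht1 E hE hdeg⟩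
end

section
/- Let K = ℚ(√−7), ω = (1+√−7)/2, 𝒪_K = ℤ[ω], and let Ē be the hermitian 𝒪_K-lattice that is free with basis (e₁,e₂,e₃) and hermitian Gram matrix [[2, ω, 1], [conj(ω), 2, 1], [1, 1, 2]] at the complex place of K (the unique indecomposable unimodular integral hermitian 𝒪_K-lattice of rank three). Fix λ ∈ ( (1/2)·log 3, log 3 − (2/3)·log 2 ]. Then Ē⟨−λ⟩ is nef, but Ē⟨−λ⟩ ⊗ Ē⟨−λ⟩ is not nef. In particular, the tensor product of nef hermitian lattices need not be nef. -/
open scoped NumberField ComplexOrder Classical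

/-! ### Arithmetic degrees of rank-one lattices -/

section Degree

variable {F : Type} [Field F] [NumberField F]

/-- Multiplying by `d` identifies a rank-one lattice `L` with an ideal; this computes the index
of a principal sublattice of `L` through ideal norms. -/
lemma card_quotient_span_mul_absNorm {L : Submodule (𝓞 F) F} {d : 𝓞 F} (hd : d ≠ 0)
    (hL : ∀ y ∈ L, ∃ z : 𝓞 F, (z : F) = d * y) {x : F} (hx : x ∈ L) {z : 𝓞 F}
    (hz : (z : F) = d * x) :
    Nat.card (↥L ⧸ Submodule.comap L.subtype (Submodule.span (𝓞 F) {x})) *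
      Ideal.absNorm (L.comap (LinearMap.toSpanSingleton (𝓞 F) F (d : F)⁻¹)) =
      Ideal.absNorm (Ideal.span {z}) := by
  have hd' : (d : F) ≠ 0 := by exact_mod_cast hd
  set φ := LinearMap.toSpanSingleton (𝓞 F) F (d : F)⁻¹ with hφ
  have hφa : ∀ t : 𝓞 F, φ t = t * (d : F)⁻¹ := fun t => by
    simp [hφ, LinearMap.toSpanSingleton_apply, Algebra.smul_def]
  have hφinj : Function.Injective φ := fun s t h => by
    rw [hφa, hφa] at h
    exact NumberField.RingOfIntegers.coe_injective (mul_right_cancel₀ (inv_ne_zero hd') h)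
  have hspan : (Ideal.span {z} : Ideal (𝓞 F)) = (Submodule.span (𝓞 F) {x}).comap φ := by
    have hzx : φ z = x := by rw [hφa, hz]; field_simp
    have := Submodule.map_span φ {z}
    rw [Set.image_singleton, hzx] at this
    rw [← this, Submodule.comap_map_eq_of_injective hφinj]
  have hle : Submodule.span (𝓞 F) {x} ≤ L := (Submodule.span_singleton_le_iff_mem _ _).2 hx
  have hmap : (L.comap φ).map φ = L := by
    apply Submodule.map_comap_eq_self
    intro y hy
    obtain ⟨t, ht⟩ := hL y hy
    exact ⟨t, by rw [hφa, ht]; field_simp⟩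
  have h1 := AddSubgroup.relIndex_comap (Submodule.span (𝓞 F) {x}).toAddSubgroup
    φ.toAddMonoidHom (L.comap φ).toAddSubgroup
  have h2 : AddSubgroup.map φ.toAddMonoidHom (L.comap φ).toAddSubgroup = L.toAddSubgroup :=
    congrArg Submodule.toAddSubgroup hmap
  have h3 := AddSubgroup.relIndex_mul_index
    (H := ((Submodule.span (𝓞 F) {x}).comap φ).toAddSubgroup)
    (K := (L.comap φ).toAddSubgroup) (fun t ht => hle ht)
  rw [Ideal.absNorm_apply, Ideal.absNorm_apply, Submodule.cardQuot_apply,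
    Submodule.cardQuot_apply, hspan]
  rw [h2] at h1
  have h4 : AddSubgroup.comap φ.toAddMonoidHom (Submodule.span (𝓞 F) {x}).toAddSubgroup =
      ((Submodule.span (𝓞 F) {x}).comap φ).toAddSubgroup := rfl
  rw [h4] at h1
  rw [h1] at h3
  exact h3

lemma log_absNorm_span (z : 𝓞 F) (hz : z ≠ 0) :
    Real.log (Ideal.absNorm (Ideal.span {z})) =
      ∑ σ : F →+* ℂ, Real.log (Complex.normSq (σ (z : F))) / 2 := by
  have hz' : (z : F) ≠ 0 := by exact_mod_cast hz
  have h := Algebra.norm_eq_prod_embeddings ℚ ℂ (z : F)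
  have h2 : ∏ σ : F →ₐ[ℚ] ℂ, σ (z : F) = ∏ σ : F →+* ℂ, σ (z : F) :=
    (Fintype.prod_equiv (RingHom.equivRatAlgHom F ℂ) _ _ fun σ => rfl).symm
  have h3 : ((Ideal.absNorm (Ideal.span {z}) : ℕ) : ℝ) = ∏ σ : F →+* ℂ, ‖σ (z : F)‖ := by
    rw [← norm_prod, ← h2, ← h, Ideal.absNorm_span_singleton, ← Algebra.coe_norm_int]
    simp [Nat.cast_natAbs]
  rw [h3, Real.log_prod (fun σ _ => by simpa using hz')]
  refine Finset.sum_congr rfl fun σ _ => ?_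
  rw [Complex.normSq_eq_norm_sq, Real.log_pow]
  push_cast
  ring

lemma log_sqrt_mul_normSq {g : ℝ} (hg : 0 < g) {c : ℂ} (hc : c ≠ 0) :
    Real.log (Real.sqrt (g * Complex.normSq c)) =
      Real.log g / 2 + Real.log (Complex.normSq c) / 2 := by
  have := Complex.normSq_pos.2 hc
  rw [Real.log_sqrt (by positivity), Real.log_mul hg.ne' this.ne']
  ring

/-- The degree of a rank-one lattice is at least minus the logarithmic size of any of its nonzero
elements. -/
lemma neg_sum_log_le_degLine_s11 {L : Submodule (𝓞 F) F} {d : 𝓞 F} (hd : d ≠ 0)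
    (hL : ∀ y ∈ L, ∃ z : 𝓞 F, (z : F) = d * y) {g : (F →+* ℂ) → ℝ} (hg : ∀ σ, 0 < g σ)
    {l : F} (hl : l ∈ L) (hl0 : l ≠ 0) :
    -(∑ σ : F →+* ℂ, Real.log (g σ * Complex.normSq (σ l)) / 2) ≤ degLine F L g := by
  have hd' : (d : F) ≠ 0 := by exact_mod_cast hd
  have h : ∃ x : F, x ∈ L ∧ x ≠ 0 := ⟨l, hl, hl0⟩
  rw [degLine, dif_pos h, finsum_eq_sum_of_fintype]
  obtain ⟨hx, hx0⟩ := h.choose_spec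
  set x := h.choose
  obtain ⟨zx, hzx⟩ := hL x hx
  obtain ⟨zl, hzl⟩ := hL l hl
  have hzx0 : zx ≠ 0 := by
    rintro rfl
    exact mul_ne_zero hd' hx0 (by simpa using hzx.symm)
  have hzl0 : zl ≠ 0 := by
    rintro rfl
    exact mul_ne_zero hd' hl0 (by simpa using hzl.symm)
  have hcx := card_quotient_span_mul_absNorm hd hL hx hzx
  have hcl := card_quotient_span_mul_absNorm hd hL hl hzl
  set I := Ideal.absNorm (L.comap (LinearMap.toSpanSingleton (𝓞 F) F (d : F)⁻¹))
  set C := Nat.card (↥L ⧸ Submodule.comap L.subtype (Submodule.span (𝓞 F) {x}))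
  have hne : ∀ z : 𝓞 F, z ≠ 0 → Ideal.absNorm (Ideal.span {z}) ≠ 0 := fun z hz => by
    simpa [Ideal.absNorm_eq_zero_iff] using hz
  have hC : C ≠ 0 := fun h0 => hne zx hzx0 (by rw [← hcx, h0, zero_mul])
  have hI : I ≠ 0 := fun h0 => hne zx hzx0 (by rw [← hcx, h0, mul_zero])
  have hIl : Real.log I ≤ Real.log (Ideal.absNorm (Ideal.span {zl})) :=
    Real.log_le_log (by positivity) (by
      exact_mod_cast Nat.le_of_dvd (Nat.pos_of_ne_zero (hne zl hzl0)) (Dvd.intro_left _ hcl))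
  have hlogC : Real.log C + Real.log I = Real.log (Ideal.absNorm (Ideal.span {zx})) := by
    rw [← hcx, Nat.cast_mul, Real.log_mul (by positivity) (by positivity)]
  rw [log_absNorm_span zl hzl0] at hIl
  rw [log_absNorm_span zx hzx0] at hlogC
  have key : ∑ σ : F →+* ℂ, Real.log (Complex.normSq (σ (zx : F))) / 2 -
      ∑ σ : F →+* ℂ, Real.log (Complex.normSq (σ (zl : F))) / 2 -
      ∑ σ : F →+* ℂ, Real.log (Real.sqrt (g σ * Complex.normSq (σ x))) =
      -(∑ σ : F →+* ℂ, Real.log (g σ * Complex.normSq (σ l)) / 2) := by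
    rw [← Finset.sum_sub_distrib, ← Finset.sum_sub_distrib, ← Finset.sum_neg_distrib]
    refine Finset.sum_congr rfl fun σ _ => ?_
    have e : ∀ y : F, y ≠ 0 → Complex.normSq (σ y) ≠ 0 := fun y hy => by simpa using hy
    rw [log_sqrt_mul_normSq (hg σ) (by simpa using hx0), hzx, hzl, map_mul, map_mul,
      map_mul, map_mul, Real.log_mul (e _ hd') (e _ hx0), Real.log_mul (e _ hd') (e _ hl0),
      Real.log_mul (hg σ).ne' (e _ hl0)]
    ring
  linarith

/-- A rank-one lattice has nonnegative degree as soon as it contains a nonempty finite family of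
nonzero elements the product of whose norms is at most one at every place. -/
lemma degLine_nonneg_of_prod_le_one {L : Submodule (𝓞 F) F} {d : 𝓞 F} (hd : d ≠ 0)
    (hL : ∀ y ∈ L, ∃ z : 𝓞 F, (z : F) = d * y) {g : (F →+* ℂ) → ℝ} (hg : ∀ σ, 0 < g σ)
    {ι : Type} [Fintype ι] [Nonempty ι] (l : ι → F) (hl : ∀ i, l i ∈ L) (hl0 : ∀ i, l i ≠ 0)
    (hprod : ∀ σ, ∑ i, Real.log (g σ * Complex.normSq (σ (l i))) ≤ 0) :
    0 ≤ degLine F L g := by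
  have h := Finset.sum_le_sum fun i (_ : i ∈ Finset.univ) =>
    neg_sum_log_le_degLine_s11 hd hL hg (hl i) (hl0 i)
  rw [Finset.sum_neg_distrib, Finset.sum_comm, Finset.sum_const, nsmul_eq_mul] at h
  have h2 : ∑ σ : F →+* ℂ, ∑ i, Real.log (g σ * Complex.normSq (σ (l i))) / 2 ≤ 0 :=
    Finset.sum_nonpos fun σ _ => by
      rw [← Finset.sum_div]
      linarith [hprod σ]
  have hpos : (0 : ℝ) < (Finset.univ : Finset ι).card := by
    exact_mod_cast Finset.card_pos.2 Finset.univ_nonempty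
  exact nonneg_of_mul_nonneg_right (by linarith) hpos

/-- The degree of the lattice `𝒪_F`. -/
lemma degLine_ringOfIntegers {L : Submodule (𝓞 F) F} (hL : ∀ y, y ∈ L ↔ ∃ z : 𝓞 F, (z : F) = y)
    {g : (F →+* ℂ) → ℝ} (hg : ∀ σ, 0 < g σ) :
    degLine F L g = -(∑ σ : F →+* ℂ, Real.log (g σ) / 2) := by
  have h : ∃ x : F, x ∈ L ∧ x ≠ 0 := ⟨1, (hL 1).2 ⟨1, by simp⟩, one_ne_zero⟩
  rw [degLine, dif_pos h, finsum_eq_sum_of_fintype]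
  obtain ⟨hx, hx0⟩ := h.choose_spec
  set x := h.choose
  obtain ⟨z, hz⟩ := (hL x).1 hx
  have hz0 : z ≠ 0 := by
    rintro rfl
    exact hx0 (by simpa using hz.symm)
  have hc := card_quotient_span_mul_absNorm (d := 1) one_ne_zero
    (fun y hy => by simpa using (hL y).1 hy) hx (z := z) (by simpa using hz)
  have htop : L.comap (LinearMap.toSpanSingleton (𝓞 F) F ((1 : 𝓞 F) : F)⁻¹) = ⊤ := by
    rw [eq_top_iff]
    intro t _
    rw [Submodule.mem_comap, hL]
    exact ⟨t, by simp [LinearMap.toSpanSingleton_apply, Algebra.smul_def]⟩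
  rw [htop, Ideal.absNorm_top, mul_one] at hc
  rw [hc, log_absNorm_span z hz0, ← Finset.sum_sub_distrib, ← Finset.sum_neg_distrib]
  refine Finset.sum_congr rfl fun σ _ => ?_
  rw [log_sqrt_mul_normSq (hg σ) (by simpa using hx0), hz]
  ring

end Degree

/-! ### Quotient metrics -/

section QuotientMetric

open Matrix

lemma cForm_smul_conjTranspose_mul {ι κ : Type} [Fintype ι] [Fintype κ] (c : ℝ)
    (B : Matrix κ ι ℂ) (e : ι → ℂ) :
    (cForm ((c : ℂ) • (Bᴴ * B)) e e).re = c * ∑ k, Complex.normSq ((B *ᵥ e) k) := by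
  have h : cForm ((c : ℂ) • (Bᴴ * B)) e e = c * (star (B *ᵥ e) ⬝ᵥ (B *ᵥ e)) := by
    rw [star_mulVec, ← dotProduct_mulVec, mulVec_mulVec, ← smul_eq_mul, ← dotProduct_smul,
      ← smul_mulVec]
    simp only [cForm, dotProduct, mulVec, Finset.mul_sum, Pi.star_apply, mul_assoc]
    rfl
  have h2 : star (B *ᵥ e) ⬝ᵥ (B *ᵥ e) = ((∑ k, Complex.normSq ((B *ᵥ e) k) : ℝ) : ℂ) := by
    simp only [dotProduct, Pi.star_apply, Complex.ofReal_sum]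
    exact Finset.sum_congr rfl fun k _ => (Complex.normSq_eq_conj_mul_self).symm
  rw [h, h2, ← Complex.ofReal_mul, Complex.ofReal_re]

lemma one_le_sum_normSq_mul_sum_normSq {κ : Type} [Fintype κ] {β y : κ → ℂ}
    (h : ∑ k, β k * y k = 1) :
    1 ≤ (∑ k, Complex.normSq (β k)) * ∑ k, Complex.normSq (y k) := by
  have h1 : (1 : ℝ) ≤ ∑ k, ‖β k‖ * ‖y k‖ := by
    calc (1 : ℝ) = ‖∑ k, β k * y k‖ := by rw [h, norm_one]
      _ ≤ ∑ k, ‖β k * y k‖ := norm_sum_le _ _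
      _ = _ := by simp
  have h2 := Finset.sum_mul_sq_le_sq_mul_sq Finset.univ (fun k => ‖β k‖) (fun k => ‖y k‖)
  simp only [Complex.normSq_eq_norm_sq]
  nlinarith

/-- If the metric at `σ` is `c ‖B e‖²` with `B` right invertible, and the linear form `ψ` is
`β ∘ B` at `σ`, then the quotient metric is `c / ‖β‖²`. -/
lemma quotMetric_eq {F : Type} [Field F] {ι κ : Type} [Fintype ι] [DecidableEq ι] [Fintype κ]
    [DecidableEq κ] (H' : (F →+* ℂ) → Matrix ι ι ℂ) (ψ : (ι → F) →ₗ[F] F) (σ : F →+* ℂ)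
    (B : Matrix κ ι ℂ) (C : Matrix ι κ ℂ) (hBC : B * C = 1) {c : ℝ} (hc : 0 < c)
    (hH : H' σ = (c : ℂ) • (Bᴴ * B)) (β : κ → ℂ)
    (hβ : ∀ i, σ (ψ (Pi.single i 1)) = (β ᵥ* B) i) (hβ0 : 0 < ∑ k, Complex.normSq (β k)) :
    quotMetric H' ψ σ = c / ∑ k, Complex.normSq (β k) := by
  set N := ∑ k, Complex.normSq (β k) with hN
  have hfib : ∀ e : ι → ℂ, ∑ i, σ (ψ (Pi.single i 1)) * e i = ∑ k, β k * (B *ᵥ e) k := fun e => by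
    simp only [hβ]
    exact (dotProduct_mulVec β B e).symm
  refine IsLeast.csInf_eq ⟨?_, ?_⟩
  · have hy : B *ᵥ (C *ᵥ fun k => star (β k) / (N : ℂ)) = fun k => star (β k) / (N : ℂ) := by
      rw [mulVec_mulVec, hBC, one_mulVec]
    have hNC : (N : ℂ) ≠ 0 := by exact_mod_cast hβ0.ne'
    refine ⟨C *ᵥ fun k => star (β k) / (N : ℂ), ?_, ?_⟩
    · rw [hfib, hy]
      simp only [← mul_div_assoc, ← Finset.sum_div]
      rw [div_eq_one_iff_eq hNC, hN, Complex.ofReal_sum]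
      exact Finset.sum_congr rfl fun k _ => Complex.mul_conj (β k)
    · rw [hH, cForm_smul_conjTranspose_mul, hy]
      simp only [map_div₀, Complex.normSq_ofReal, ← Finset.sum_div]
      have : ∑ k, Complex.normSq (star (β k)) = N :=
        Finset.sum_congr rfl fun k _ => Complex.normSq_conj (β k)
      rw [this]
      field_simp
  · rintro t ⟨e, he, rfl⟩
    rw [hfib] at he
    rw [hH, cForm_smul_conjTranspose_mul, div_le_iff₀ hβ0, mul_assoc]
    have := one_le_sum_normSq_mul_sum_normSq he
    nlinarith

end QuotientMetric

/-! ### Orthogonal frames of roots -/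

section Frames

/-- A second orthogonal frame, sharing no root with the orthogonal frame with coordinates `b`. -/
def crossFrame {R : Type} [Field R] (w : R) (b : Fin 3 → R) : Fin 3 → R :=
  ![w * (b 1 + b 2) / 2, ((1 - w) * b 0 + b 1 - b 2) / 2, ((1 - w) * b 0 - b 1 + b 2) / 2]

/-- Seven orthogonal frames which together contain each of the 21 pairs of roots once. -/
def frames {R : Type} [Field R] (w : R) (b : Fin 3 → R) : Fin 7 → Fin 3 → R :=
  ![b, crossFrame w ![b 0, b 1, b 2], crossFrame w ![b 0, b 1, -b 2],
    crossFrame w ![b 1, b 0, b 2], crossFrame w ![b 1, b 0, -b 2],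
    crossFrame w ![b 2, b 0, b 1], crossFrame w ![b 2, b 0, -b 1]]

lemma map_frames {R R' : Type} [Field R] [Field R'] (σ : R →+* R') (w : R) (b : Fin 3 → R)
    (j : Fin 7) (i : Fin 3) : σ (frames w b j i) = frames (σ w) (fun k => σ (b k)) j i := by
  have h2 : σ 2 = 2 := map_ofNat σ 2
  fin_cases j <;> fin_cases i <;> simp [frames, crossFrame, h2]

lemma re_im_of_sq_eq {w : ℂ} (hw : w ^ 2 = w - 2) : w.re = 1 / 2 ∧ w.im ^ 2 = 7 / 4 := by
  have h1 := congrArg Complex.re hw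
  have h2 := congrArg Complex.im hw
  simp [pow_two] at h1 h2
  have h3 : w.im * (2 * w.re - 1) = 0 := by linarith
  rcases mul_eq_zero.1 h3 with h | h
  · rw [h] at h1
    nlinarith [sq_nonneg (w.re - 1 / 2)]
  · have h4 : w.re = 1 / 2 := by linarith
    refine ⟨h4, ?_⟩
    rw [h4] at h1
    linarith

lemma conj_eq_of_sq_eq {w : ℂ} (hw : w ^ 2 = w - 2) : (starRingEnd ℂ) w = 1 - w := by
  have := (re_im_of_sq_eq hw).1
  apply Complex.ext <;> simp [this]
  norm_num

lemma normSq_crossFrame {w : ℂ} (hw : w ^ 2 = w - 2) (a b c : ℂ) :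
    Complex.normSq (crossFrame w ![a, b, c] 0) = ((b.re + c.re) ^ 2 + (b.im + c.im) ^ 2) / 2 ∧
    Complex.normSq (crossFrame w ![a, b, c] 1) =
      (2 * (a.re ^ 2 + a.im ^ 2) + (b.re - c.re) ^ 2 + (b.im - c.im) ^ 2
        + (a.re * (b.re - c.re) + a.im * (b.im - c.im))
        + 2 * w.im * (a.im * (b.re - c.re) - a.re * (b.im - c.im))) / 4 ∧
    Complex.normSq (crossFrame w ![a, b, c] 2) =
      (2 * (a.re ^ 2 + a.im ^ 2) + (b.re - c.re) ^ 2 + (b.im - c.im) ^ 2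
        - (a.re * (b.re - c.re) + a.im * (b.im - c.im))
        - 2 * w.im * (a.im * (b.re - c.re) - a.re * (b.im - c.im))) / 4 := by
  obtain ⟨h1, h2⟩ := re_im_of_sq_eq hw
  simp only [crossFrame, Complex.normSq_div, Complex.normSq_ofNat, Matrix.cons_val_zero,
    Matrix.cons_val_one, Matrix.cons_val]
  simp only [Complex.normSq_apply, Complex.mul_re, Complex.mul_im,
    Complex.add_re, Complex.add_im, Complex.sub_re, Complex.sub_im, Complex.one_re,
    Complex.one_im, h1]
  refine ⟨?_, ?_, ?_⟩
  · linear_combination (((b.re + c.re) ^ 2 + (b.im + c.im) ^ 2) / 4) * h2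
  · linear_combination ((a.re ^ 2 + a.im ^ 2) / 4) * h2
  · linear_combination ((a.re ^ 2 + a.im ^ 2) / 4) * h2

lemma sum_normSq_crossFrame {w : ℂ} (hw : w ^ 2 = w - 2) (b : Fin 3 → ℂ) :
    ∑ i, Complex.normSq (crossFrame w b i) = ∑ i, Complex.normSq (b i) := by
  have hb : b = ![b 0, b 1, b 2] := by ext i; fin_cases i <;> rfl
  obtain ⟨h0, h1, h2⟩ := normSq_crossFrame hw (b 0) (b 1) (b 2)
  rw [← hb] at h0 h1 h2
  rw [Fin.sum_univ_three, Fin.sum_univ_three, h0, h1, h2]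
  simp only [Complex.normSq_apply]
  ring

lemma sum_normSq_frames {w : ℂ} (hw : w ^ 2 = w - 2) (b : Fin 3 → ℂ) (j : Fin 7) :
    ∑ i, Complex.normSq (frames w b j i) = ∑ i, Complex.normSq (b i) := by
  fin_cases j <;>
    simp [frames, sum_normSq_crossFrame hw, Fin.sum_univ_three] <;> ring

/-- The 21 pairs of roots form a projective design of strength two. -/
lemma sum_frames_pairs {w : ℂ} (hw : w ^ 2 = w - 2) (b : Fin 3 → ℂ) :
    ∑ j, (Complex.normSq (frames w b j 0) * Complex.normSq (frames w b j 1) +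
      Complex.normSq (frames w b j 1) * Complex.normSq (frames w b j 2) +
      Complex.normSq (frames w b j 0) * Complex.normSq (frames w b j 2)) =
      7 / 4 * (∑ i, Complex.normSq (b i)) ^ 2 := by
  have hv := (re_im_of_sq_eq hw).2
  have h := normSq_crossFrame hw
  rw [Fin.sum_univ_seven, Fin.sum_univ_three]
  simp only [frames, Matrix.cons_val, (h _ _ _).1, (h _ _ _).2.1, (h _ _ _).2.2,
    Complex.normSq_apply, Complex.neg_re, Complex.neg_im]
  linear_combination (-(((b 0).im * (b 1).re - (b 0).re * (b 1).im) ^ 2 +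
    ((b 0).im * (b 2).re - (b 0).re * (b 2).im) ^ 2 +
    ((b 1).im * (b 2).re - (b 1).re * (b 2).im) ^ 2)) * hv

end Frames

/-! ### The product of the roots on the unit sphere -/

section RootProduct

lemma log_two_mul_add_log_le {m : ℝ} (h0 : 0 < m) (h1 : m ≤ 1 / 3) :
    Real.log 54 + 2 * Real.log m + Real.log (1 - 2 * m) ≤ 18 * m - 27 * m ^ 2 - 9 / 4 := by
  set D : ℝ → ℝ := fun x =>
    Real.log 54 + 2 * Real.log x + Real.log (1 - 2 * x) - (18 * x - 27 * x ^ 2 - 9 / 4) with hD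
  have hder : ∀ x : ℝ, 0 < x → x ≤ 1 / 3 →
      HasDerivAt D (108 * (1 / 6 - x) * (1 / 3 - x) ^ 2 / (x * (1 - 2 * x))) x := by
    intro x hx hx1
    have hx2 : 1 - 2 * x ≠ 0 := by linarith
    have d1 := (Real.hasDerivAt_log hx.ne').const_mul 2
    have d2 : HasDerivAt (fun x : ℝ => 1 - 2 * x) (-(2 * 1)) x :=
      ((hasDerivAt_id x).const_mul 2).const_sub 1
    have d3 := d2.log hx2
    have d4 : HasDerivAt (fun x : ℝ => 18 * x - 27 * x ^ 2 - 9 / 4)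
        (18 * 1 - 27 * (2 * x)) x := by
      have := (((hasDerivAt_id x).const_mul 18).sub (((hasDerivAt_id x).pow 2).const_mul 27)).sub_const
        (9 / 4)
      simpa using this
    have d5 := ((d1.const_add (Real.log 54)).add d3).sub d4
    refine d5.congr_deriv ?_
    field_simp
    ring
  have hval : D (1 / 6) = 0 := by
    have : Real.log 54 + 2 * Real.log (1 / 6) + Real.log (1 - 2 * (1 / 6)) = 0 := by
      rw [← Real.log_rpow (by norm_num), ← Real.log_mul (by norm_num) (by norm_num),
        ← Real.log_mul (by norm_num) (by norm_num)]
      norm_num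
    simp only [hD, this]
    norm_num
  suffices D m ≤ D (1 / 6) by
    rw [hval] at this
    simp only [hD] at this
    linarith
  rcases le_total m (1 / 6) with hm | hm
  · refine monotoneOn_of_deriv_nonneg (convex_Icc m (1 / 6))
      (fun x hx => (hder x (by linarith [hx.1]) (by linarith [hx.2])).continuousAt.continuousWithinAt)
      (fun x hx => ?_) (fun x hx => ?_) (Set.left_mem_Icc.2 hm) (Set.right_mem_Icc.2 hm) hm
    all_goals rw [interior_Icc] at hx
    · exact (hder x (by linarith [hx.1]) (by linarith [hx.2])).differentiableAt.differentiableWithinAt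
    · rw [(hder x (by linarith [hx.1]) (by linarith [hx.2])).deriv]
      have := hx.1
      have := hx.2
      exact div_nonneg (mul_nonneg (by linarith) (sq_nonneg _))
        (mul_nonneg (by linarith) (by linarith))
  · refine antitoneOn_of_deriv_nonpos (convex_Icc (1 / 6) m)
      (fun x hx => (hder x (by linarith [hx.1]) (by linarith [hx.2])).continuousAt.continuousWithinAt)
      (fun x hx => ?_) (fun x hx => ?_) (Set.left_mem_Icc.2 hm) (Set.right_mem_Icc.2 hm) hm
    all_goals rw [interior_Icc] at hx
    · exact (hder x (by linarith [hx.1]) (by linarith [hx.2])).differentiableAt.differentiableWithinAt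
    · rw [(hder x (by linarith [hx.1]) (by linarith [hx.2])).deriv]
      have := hx.1
      have := hx.2
      exact div_nonpos_of_nonpos_of_nonneg
        (mul_nonpos_of_nonpos_of_nonneg (by linarith) (sq_nonneg _))
        (mul_nonneg (by linarith) (by linarith))

lemma log_prod_three_le_of_le {x y z : ℝ} (hx : 0 < x) (hy : 0 < y) (hsum : x + y + z = 1)
    (hz : 1 / 3 ≤ z) :
    Real.log 54 + (Real.log x + Real.log y + Real.log z) ≤
      9 * (x * y + y * z + x * z) - 9 / 4 := by
  have hm0 : 0 < (x + y) / 2 := by positivity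
  have h := log_two_mul_add_log_le hm0 (by linarith)
  have hz' : 1 - 2 * ((x + y) / 2) = z := by linarith
  rw [hz'] at h
  set m := (x + y) / 2 with hm
  have h1 : Real.log (x * y / m ^ 2) ≤ x * y / m ^ 2 - 1 :=
    Real.log_le_sub_one_of_pos (by positivity)
  rw [Real.log_div (by positivity) (by positivity), Real.log_mul hx.ne' hy.ne',
    Real.log_pow] at h1
  have hxy : x * y ≤ m ^ 2 := by
    rw [hm]
    nlinarith [sq_nonneg (x - y)]
  have h9 : m ^ 2 ≤ 1 / 9 := by nlinarith
  have h2 : x * y / m ^ 2 - 1 ≤ 9 * (x * y - m ^ 2) := by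
    have hmm : 0 < m ^ 2 := by positivity
    rw [div_sub_one hmm.ne', div_le_iff₀ hmm]
    nlinarith [mul_nonneg (sub_nonneg.2 hxy) (sub_nonneg.2 h9)]
  have hzm : z = 1 - 2 * m := hz'.symm
  have hxm : y = 2 * m - x := by rw [hm]; ring
  push_cast at h1
  have h3 : x * y + y * z + x * z = x * y + 2 * m * (1 - 2 * m) := by
    rw [hzm, hxm]
    ring
  rw [h3]
  linarith

lemma log_prod_three_le {x y z : ℝ} (hx : 0 < x) (hy : 0 < y) (hz : 0 < z)
    (hsum : x + y + z = 1) :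
    Real.log 54 + (Real.log x + Real.log y + Real.log z) ≤
      9 * (x * y + y * z + x * z) - 9 / 4 := by
  by_cases h1 : 1 / 3 ≤ z
  · exact log_prod_three_le_of_le hx hy hsum h1
  by_cases h2 : 1 / 3 ≤ y
  · linarith [log_prod_three_le_of_le hx hz (by linarith) h2]
  · have h3 : 1 / 3 ≤ x := by linarith
    linarith [log_prod_three_le_of_le hz hy (by linarith) h3]

lemma sum_log_frames_le {w : ℂ} (hw : w ^ 2 = w - 2) (b : Fin 3 → ℂ)
    (hb : ∀ j i, frames w b j i ≠ 0) {lam : ℝ}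
    (hlam : lam ≤ Real.log 3 - (2 / 3) * Real.log 2) :
    ∑ p : Fin 7 × Fin 3, Real.log (Real.exp lam / 2 / (∑ k, Complex.normSq (b k)) *
      Complex.normSq (2 * frames w b p.1 p.2)) ≤ 0 := by
  set S := ∑ k, Complex.normSq (b k) with hS
  have hpos : ∀ j i, 0 < Complex.normSq (frames w b j i) := fun j i =>
    Complex.normSq_pos.2 (hb j i)
  have hS0 : 0 < S := by
    rw [hS, ← sum_normSq_frames hw b 0]
    exact Finset.sum_pos (fun i _ => hpos 0 i) Finset.univ_nonempty
  have h54 : Real.log 54 = Real.log 2 + 3 * Real.log 3 := by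
    rw [show (54 : ℝ) = 2 * 3 ^ 3 by norm_num, Real.log_mul (by norm_num) (by norm_num),
      Real.log_pow]
    norm_num
  have hterm : ∀ j i, Real.log (Real.exp lam / 2 / S * Complex.normSq (2 * frames w b j i)) =
      lam + Real.log 2 + Real.log (Complex.normSq (frames w b j i) / S) := by
    intro j i
    have := hpos j i
    rw [show Real.exp lam / 2 / S * Complex.normSq (2 * frames w b j i) =
      Real.exp lam * 2 * (Complex.normSq (frames w b j i) / S) by
        rw [Complex.normSq_mul, Complex.normSq_ofNat]; field_simp,
      Real.log_mul (by positivity) (by positivity), Real.log_mul (by positivity) (by norm_num),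
      Real.log_exp]
  have hframe : ∀ j, ∑ i, Real.log (Real.exp lam / 2 / S * Complex.normSq (2 * frames w b j i)) ≤
      9 / S ^ 2 * (Complex.normSq (frames w b j 0) * Complex.normSq (frames w b j 1) +
        Complex.normSq (frames w b j 1) * Complex.normSq (frames w b j 2) +
        Complex.normSq (frames w b j 0) * Complex.normSq (frames w b j 2)) - 9 / 4 := by
    intro j
    have hsum := sum_normSq_frames hw b j
    rw [Fin.sum_univ_three, ← hS] at hsum
    have h := log_prod_three_le (div_pos (hpos j 0) hS0) (div_pos (hpos j 1) hS0)
      (div_pos (hpos j 2) hS0) (by rw [← add_div, ← add_div, hsum, div_self hS0.ne'])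
    simp only [hterm]
    rw [Fin.sum_univ_three]
    refine le_trans ?_ (h.trans (le_of_eq ?_))
    · linarith
    · field_simp
  rw [Fintype.sum_prod_type]
  refine (Finset.sum_le_sum fun j _ => hframe j).trans (le_of_eq ?_)
  rw [Finset.sum_sub_distrib, ← Finset.mul_sum, sum_frames_pairs hw b, ← hS]
  simp
  field_simp
  norm_num

end RootProduct

/-! ### Rank-one quotients of a base change -/

section RankOneQuotient

variable {K F : Type} [Field K] [NumberField K] [Field F] [Algebra K F] {ι : Type} [Fintype ι]

lemma apply_mem_map_baseChange [NumberField F] [DecidableEq ι]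
    {E : Submodule (𝓞 K) (ι → K)} (ψ : (ι → F) →ₗ[F] F) {i : ι} (hi : Pi.single i 1 ∈ E) :
    ψ (Pi.single i 1) ∈ (baseChange K F E).map (ψ.restrictScalars (𝓞 F)) := by
  refine Submodule.mem_map_of_mem (f := ψ.restrictScalars (𝓞 F))
    (Submodule.subset_span ⟨_, hi, ?_⟩)
  ext j
  rcases eq_or_ne j i with rfl | h
  · simp
  · simp [h]

lemma baseChange_le_pi_one [NumberField F] {E : Submodule (𝓞 K) (ι → K)}
    (hE : E ≤ Submodule.pi Set.univ fun _ => 1) :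
    baseChange K F E ≤ Submodule.pi Set.univ fun _ => 1 := by
  rw [baseChange, Submodule.span_le]
  rintro _ ⟨v, hv, rfl⟩ i _
  obtain ⟨z, hz⟩ := Submodule.mem_one.1 (hE hv i trivial)
  refine Submodule.mem_one.2 ⟨NumberField.RingOfIntegers.mapRingHom (algebraMap K F) z, ?_⟩
  exact (NumberField.RingOfIntegers.mapRingHom_apply _ z).trans (congrArg (algebraMap K F) hz)

lemma map_le_span_range [DecidableEq ι] {M : Submodule (𝓞 F) (ι → F)}
    (hM : M ≤ Submodule.pi Set.univ fun _ => 1) (ψ : (ι → F) →ₗ[F] F) :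
    M.map (ψ.restrictScalars (𝓞 F)) ≤
      Submodule.span (𝓞 F) (Set.range fun i => ψ (Pi.single i 1)) := by
  rintro _ ⟨v, hv, rfl⟩
  rw [LinearMap.restrictScalars_apply, LinearMap.pi_apply_eq_sum_univ]
  refine Submodule.sum_mem _ fun i _ => ?_
  obtain ⟨z, hz⟩ := Submodule.mem_one.1 (hM hv i trivial)
  rw [← hz, algebraMap_smul]
  refine Submodule.smul_mem _ _ (Submodule.subset_span ⟨i, ?_⟩)
  refine congrArg ψ (funext fun j => ?_)
  simp [Pi.single_apply, eq_comm]

lemma exists_denominator [NumberField F] (a : ι → F) : ∃ d : 𝓞 F, d ≠ 0 ∧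
    ∀ y ∈ Submodule.span (𝓞 F) (Set.range a), ∃ z : 𝓞 F, (z : F) = d * y := by
  obtain ⟨d, hd⟩ := IsLocalization.exist_integer_multiples_of_finite (nonZeroDivisors (𝓞 F)) a
  refine ⟨d, nonZeroDivisors.coe_ne_zero d, fun y hy => ?_⟩
  induction hy using Submodule.span_induction with
  | mem y hy =>
    obtain ⟨i, rfl⟩ := hy
    obtain ⟨z, hz⟩ := hd i
    exact ⟨z, by rw [← Algebra.smul_def]; exact hz⟩
  | zero => exact ⟨0, by simp⟩
  | add x y _ _ hx hy =>
    obtain ⟨s, hs⟩ := hx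
    obtain ⟨t, ht⟩ := hy
    exact ⟨s + t, by rw [mul_add, ← hs, ← ht]; exact map_add _ s t⟩
  | smul r y _ hy =>
    obtain ⟨t, ht⟩ := hy
    exact ⟨r * t, by rw [Algebra.smul_def, mul_left_comm, ← ht]; exact map_mul _ r t⟩

end RankOneQuotient

/-! ### Frames of roots in a rank-one quotient -/

section RootFrames

variable {F : Type} [Field F]

/-- The condition on the coordinates `b` of a linear form, with respect to an orthogonal frame of
roots, that the lattice `L` contains its values on the unimodular lattice. -/
def IsRootFrame (L : Submodule (𝓞 F) F) (w : F) (b : Fin 3 → F) : Prop :=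
  ∀ i, 2 * b i ∈ L ∧ ∑ k, b k - w * b i ∈ L

lemma coe_mul_mem {L : Submodule (𝓞 F) F} (z : 𝓞 F) {y : F} (hy : y ∈ L) : (z : F) * y ∈ L := by
  rw [← Algebra.smul_def]
  exact L.smul_mem z hy

variable {L : Submodule (𝓞 F) F} {w : 𝓞 F} {b : Fin 3 → F}

lemma IsRootFrame.comp (h : IsRootFrame L w b) (e : Equiv.Perm (Fin 3)) :
    IsRootFrame L w (b ∘ e) := fun i => by
  simpa [Equiv.sum_comp e b] using h (e i)

lemma IsRootFrame.neg_last (h : IsRootFrame L w b) : IsRootFrame L w ![b 0, b 1, -b 2] := by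
  have h2 := (h 2).1
  have hw2 := coe_mul_mem w h2
  intro i
  fin_cases i
  · refine ⟨(h 0).1, ?_⟩
    convert L.sub_mem (h 0).2 h2 using 1
    simp [Fin.sum_univ_three]
    ring
  · refine ⟨(h 1).1, ?_⟩
    convert L.sub_mem (h 1).2 h2 using 1
    simp [Fin.sum_univ_three]
    ring
  · refine ⟨by simpa using h2, ?_⟩
    convert L.add_mem (L.sub_mem (h 2).2 h2) hw2 using 1
    simp [Fin.sum_univ_three]
    ring

lemma IsRootFrame.mul_sum_sub_mem (hw : (w : F) ^ 2 = w - 2) (h : IsRootFrame L w b)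
    (i : Fin 3) : w * (∑ k, b k - b i) ∈ L := by
  convert L.sub_mem (coe_mul_mem w (h i).2) (h i).1 using 1
  linear_combination b i * hw

lemma IsRootFrame.crossFrame [CharZero F] (hw : (w : F) ^ 2 = w - 2) (h : IsRootFrame L w b) :
    IsRootFrame L w (crossFrame w b) := by
  have h0 := h.mul_sum_sub_mem hw 0
  have h1 := h.mul_sum_sub_mem hw 1
  have h2 := h.mul_sum_sub_mem hw 2
  simp only [Fin.sum_univ_three] at h0 h1 h2
  intro i
  simp only [Fin.sum_univ_three]
  have e := fun k => (h k).2
  simp only [Fin.sum_univ_three] at e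
  fin_cases i
  · refine ⟨?_, ?_⟩
    · convert h0 using 1
      simp [_root_.crossFrame]
      ring
    · convert e 0 using 1
      simp [_root_.crossFrame]
      linear_combination (-(b 1 + b 2) / 2) * hw
  · refine ⟨?_, ?_⟩
    · convert L.sub_mem (e 0) (h 2).1 using 1
      simp [_root_.crossFrame]
      ring
    · convert L.sub_mem h1 (coe_mul_mem w (h 0).1) using 1
      simp [_root_.crossFrame]
      linear_combination (b 0 / 2) * hw
  · refine ⟨?_, ?_⟩
    · convert L.sub_mem (e 0) (h 1).1 using 1
      simp [_root_.crossFrame]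
      ring
    · convert L.sub_mem h2 (coe_mul_mem w (h 0).1) using 1
      simp [_root_.crossFrame]
      linear_combination (b 0 / 2) * hw

lemma IsRootFrame.frames [CharZero F] (hw : (w : F) ^ 2 = w - 2) (h : IsRootFrame L w b)
    (j : Fin 7) : IsRootFrame L w (frames w b j) := by
  have h0 : IsRootFrame L w ![b 0, b 1, b 2] := by
    convert h using 1
    ext i
    fin_cases i <;> rfl
  have h1 : IsRootFrame L w ![b 1, b 0, b 2] := by
    convert h.comp (Equiv.swap 0 1) using 1
    ext i
    fin_cases i <;> rfl
  have h2 : IsRootFrame L w ![b 2, b 0, b 1] := by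
    convert h.comp (finRotate 3)⁻¹ using 1
    ext i
    fin_cases i <;> rfl
  fin_cases j
  · exact h
  · exact h0.crossFrame hw
  · exact h0.neg_last.crossFrame hw
  · exact h1.crossFrame hw
  · exact h1.neg_last.crossFrame hw
  · exact h2.crossFrame hw
  · exact h2.neg_last.crossFrame hw

/-- The case of a linear form vanishing on a root. -/
lemma degLine_nonneg_of_isotropic [NumberField F] {d : 𝓞 F} (hd : d ≠ 0)
    (hL : ∀ y ∈ L, ∃ z : 𝓞 F, (z : F) = d * y) (hw : (w : F) ^ 2 = w - 2) {x y : F}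
    (hx : w * x ∈ L) (hy : w * y ∈ L) (hxy : x + y ∈ L) (h0 : x ≠ 0 ∨ y ≠ 0) {lam : ℝ}
    (hlam : lam ≤ Real.log 2) {g : (F →+* ℂ) → ℝ}
    (hg : ∀ σ, g σ = Real.exp lam / 2 / (Complex.normSq (σ x) + Complex.normSq (σ y))) :
    0 ≤ degLine F L g := by
  have hexp : Real.exp lam / 2 ≤ 1 := by
    have := Real.exp_le_exp.2 hlam
    rw [Real.exp_log two_pos] at this
    linarith
  have hN : ∀ σ : F →+* ℂ, 0 < Complex.normSq (σ x) + Complex.normSq (σ y) := fun σ => by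
    rcases h0 with h | h
    · exact add_pos_of_pos_of_nonneg (by simpa using h) (Complex.normSq_nonneg _)
    · exact add_pos_of_nonneg_of_pos (Complex.normSq_nonneg _) (by simpa using h)
  have hgpos : ∀ σ, 0 < g σ := fun σ => by
    rw [hg]
    have := hN σ
    positivity
  by_cases hxy0 : x ≠ 0 ∧ y ≠ 0
  · obtain ⟨hx0, hy0⟩ := hxy0
    have hw0 : (w : F) ≠ 0 := by
      intro h
      rw [h] at hw
      norm_num at hw
    refine degLine_nonneg_of_prod_le_one hd hL hgpos ![w * x, w * y] ?_ ?_ fun σ => ?_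
    · intro i
      fin_cases i
      · exact hx
      · exact hy
    · intro i
      fin_cases i
      · exact mul_ne_zero hw0 hx0
      · exact mul_ne_zero hw0 hy0
    · have hwn : Complex.normSq (σ w) = 2 := by
        have hs : (σ w) ^ 2 = σ w - 2 := by
          rw [← map_pow, hw, map_sub, map_ofNat]
        obtain ⟨h1, h2⟩ := re_im_of_sq_eq hs
        rw [Complex.normSq_apply, h1]
        linarith
      have hX : 0 < Complex.normSq (σ x) := by simpa using hx0
      have hY : 0 < Complex.normSq (σ y) := by simpa using hy0
      rw [Fin.sum_univ_two]
      simp only [Matrix.cons_val_zero, Matrix.cons_val_one, map_mul, hwn, hg]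
      rw [← Real.log_mul (by positivity) (by positivity)]
      refine Real.log_nonpos (by positivity) ?_
      set X := Complex.normSq (σ x)
      set Y := Complex.normSq (σ y)
      have h4 : Real.exp lam / 2 / (X + Y) * (2 * X) * (Real.exp lam / 2 / (X + Y) * (2 * Y)) =
          (Real.exp lam / 2) ^ 2 * (4 * X * Y / (X + Y) ^ 2) := by
        field_simp
        ring
      rw [h4]
      refine mul_le_one₀ (pow_le_one₀ (by positivity) hexp) (by positivity) ?_
      rw [div_le_one (by positivity)]
      nlinarith [sq_nonneg (X - Y)]
  · refine degLine_nonneg_of_prod_le_one hd hL hgpos (fun _ : Unit => x + y) (fun _ => hxy) ?_ ?_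
    · rintro -
      by_cases hx0 : x = 0
      · simpa [hx0] using h0
      · have hy0 : y = 0 := by tauto
        simpa [hy0] using hx0
    · intro σ
      have hs : Complex.normSq (σ (x + y)) = Complex.normSq (σ x) + Complex.normSq (σ y) := by
        by_cases hx0 : x = 0
        · simp [hx0]
        · have hy0 : y = 0 := by tauto
          simp [hy0]
      simp only [Finset.univ_unique, Finset.sum_const, Finset.card_singleton, one_smul]
      rw [hg, hs, div_mul_cancel₀ _ (hN σ).ne']
      exact Real.log_nonpos (by positivity) hexp

lemma degLine_nonneg_of_isRootFrame [NumberField F] {d : 𝓞 F} (hd : d ≠ 0)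
    (hL : ∀ y ∈ L, ∃ z : 𝓞 F, (z : F) = d * y) (hw : (w : F) ^ 2 = w - 2)
    (hb : IsRootFrame L w b) (hb0 : b ≠ 0) {lam : ℝ}
    (hlam : lam ≤ Real.log 3 - (2 / 3) * Real.log 2) {g : (F →+* ℂ) → ℝ}
    (hg : ∀ σ, g σ = Real.exp lam / 2 / ∑ k, Complex.normSq (σ (b k))) :
    0 ≤ degLine F L g := by
  have hs : ∀ σ : F →+* ℂ, (σ w) ^ 2 = σ w - 2 := fun σ => by
    rw [← map_pow, hw, map_sub, map_ofNat]
  have hN : ∀ σ : F →+* ℂ, 0 < ∑ k, Complex.normSq (σ (b k)) := fun σ => by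
    obtain ⟨i, hi⟩ := Function.ne_iff.1 hb0
    exact Finset.sum_pos' (fun k _ => Complex.normSq_nonneg _)
      ⟨i, Finset.mem_univ i, by simpa using hi⟩
  by_cases h : ∀ j i, _root_.frames (w : F) b j i ≠ 0
  · refine degLine_nonneg_of_prod_le_one hd hL (fun σ => ?_)
      (fun p : Fin 7 × Fin 3 => 2 * _root_.frames (w : F) b p.1 p.2)
      (fun p => (hb.frames hw p.1 p.2).1) (fun p => mul_ne_zero two_ne_zero (h _ _)) fun σ => ?_
    · rw [hg]
      have := hN σ
      positivity
    · simp only [hg, map_mul σ, map_ofNat σ, map_frames]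
      refine sum_log_frames_le (hs σ) (fun k => σ (b k)) (fun j i => ?_) hlam
      rw [← map_frames]
      simpa using h j i
  · push Not at h
    obtain ⟨j, i, hji⟩ := h
    set c := _root_.frames (w : F) b j
    have hc : IsRootFrame L w c := hb.frames hw j
    have hsum : ∀ σ : F →+* ℂ, ∑ k, Complex.normSq (σ (c k)) = ∑ k, Complex.normSq (σ (b k)) :=
      fun σ => by
        rw [← sum_normSq_frames (hs σ) (fun k => σ (b k)) j]
        simp only [c, map_frames]
    have hc0 : c ≠ 0 := by
      intro h0
      have σ : F →+* ℂ := Classical.arbitrary _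
      have h1 := hN σ
      rw [← hsum σ, h0] at h1
      simp at h1
    have hlam2 : lam ≤ Real.log 2 := by
      have h27 := Real.log_le_log (by norm_num) (show (27 : ℝ) ≤ 32 by norm_num)
      rw [show (27 : ℝ) = 3 ^ 3 by norm_num, show (32 : ℝ) = 2 ^ 5 by norm_num,
        Real.log_pow, Real.log_pow] at h27
      push_cast at h27
      linarith
    have key : ∀ x y : F, w * x ∈ L → w * y ∈ L → x + y ∈ L →
        (∀ σ : F →+* ℂ, ∑ k, Complex.normSq (σ (c k)) =
          Complex.normSq (σ x) + Complex.normSq (σ y)) → (x = 0 → y = 0 → c = 0) →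
        0 ≤ degLine F L g := by
      intro x y hx hy hxy hcs hxy0
      refine degLine_nonneg_of_isotropic hd hL hw hx hy hxy ?_ hlam2 fun σ => ?_
      · by_contra! h
        exact hc0 (hxy0 h.1 h.2)
      · rw [hg, ← hsum, hcs]
    have hm := hc.mul_sum_sub_mem hw
    have hci := (hc i).2
    simp only [Fin.sum_univ_three] at hm hci key
    have hext : c 0 = 0 → c 1 = 0 → c 2 = 0 → c = 0 := fun h0 h1 h2 => by
      ext k
      fin_cases k <;> assumption
    fin_cases i
    · have h0 : c 0 = 0 := hji
      exact key (c 1) (c 2) (by simpa [h0] using hm 2) (by simpa [h0] using hm 1)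
        (by simpa [h0] using hci) (fun σ => by simp [h0]) (hext h0)
    · have h0 : c 1 = 0 := hji
      exact key (c 0) (c 2) (by simpa [h0] using hm 2) (by simpa [h0] using hm 0)
        (by simpa [h0] using hci) (fun σ => by simp [h0]) (fun h1 h2 => hext h1 h0 h2)
    · have h0 : c 2 = 0 := hji
      exact key (c 0) (c 1) (by simpa [h0] using hm 1) (by simpa [h0] using hm 0)
        (by simpa [h0] using hci) (fun σ => by simp [h0]) (fun h1 h2 => hext h1 h2 h0)

end RootFrames

/-! ### The unimodular lattice of rank three -/

section RootMatrix

open Matrix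

/-- The coordinates of the standard basis in an orthogonal frame of roots. -/
def rootMatrix {R : Type} [Field R] (w : R) : Matrix (Fin 3) (Fin 3) R :=
  !![1, 1, 2; 1 - w, 1, 0; 1, -(1 - w), 0]

/-- The inverse of `rootMatrix w`. -/
def rootMatrixInv {R : Type} [Field R] (w : R) : Matrix (Fin 3) (Fin 3) R :=
  !![0, -(1 - w) ^ 2 / 2, -(1 - w) / 2; 0, -(1 - w) / 2, (1 - w) ^ 2 / 2; 1 / 2, -w / 2, 1 / 2]

lemma rootMatrix_mul_rootMatrixInv {R : Type} [Field R] [CharZero R] {w : R}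
    (hw : w ^ 2 = w - 2) : rootMatrix w * rootMatrixInv w = 1 := by
  have h3 : w ^ 3 = -w - 2 := by linear_combination (w + 1) * hw
  ext i j
  fin_cases i <;> fin_cases j <;>
    simp [rootMatrix, rootMatrixInv, Matrix.mul_apply, Fin.sum_univ_three] <;>
    ring_nf <;> simp only [hw, h3] <;> ring

lemma smul_gram_eq {w : ℂ} (hw : w ^ 2 = w - 2) (c : ℝ) :
    (c : ℂ) • !![2, w, 1; 1 - w, 2, 1; 1, 1, 2] =
      ((c / 2 : ℝ) : ℂ) • ((rootMatrix w)ᴴ * rootMatrix w) := by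
  have hc := conj_eq_of_sq_eq hw
  have h2 : (starRingEnd ℂ) 2 = 2 := map_ofNat _ 2
  ext i j
  fin_cases i <;> fin_cases j <;>
    simp [rootMatrix, Matrix.mul_apply, Fin.sum_univ_three, hc, h2] <;>
    ring_nf <;> simp only [hw] <;> ring

lemma map_rootMatrix {R R' : Type} [Field R] [Field R'] (σ : R →+* R') (w : R) :
    (rootMatrix w).map σ = rootMatrix (σ w) := by
  have h2 : σ 2 = 2 := map_ofNat σ 2
  ext i j
  fin_cases i <;> fin_cases j <;> simp [rootMatrix, h2]

lemma isRootFrame_vecMul_rootMatrixInv {F : Type} [Field F] [CharZero F]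
    {L : Submodule (𝓞 F) F} {w : 𝓞 F} (hw : (w : F) ^ 2 = w - 2) {a : Fin 3 → F}
    (ha : ∀ i, a i ∈ L) : IsRootFrame L w (a ᵥ* rootMatrixInv (w : F)) := by
  set b := a ᵥ* rootMatrixInv (w : F) with hb
  have hab : a = b ᵥ* rootMatrix (w : F) := by
    rw [hb, vecMul_vecMul, mul_eq_one_comm.1 (rootMatrix_mul_rootMatrixInv hw), vecMul_one]
  have h0 : b 0 + (1 - w) * b 1 + b 2 ∈ L := by
    convert ha 0 using 1
    rw [hab]
    simp [rootMatrix, vecMul, dotProduct, Fin.sum_univ_three]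
    ring
  have h1 : b 0 + b 1 - (1 - w) * b 2 ∈ L := by
    convert ha 1 using 1
    rw [hab]
    simp [rootMatrix, vecMul, dotProduct, Fin.sum_univ_three]
    ring
  have h2 : 2 * b 0 ∈ L := by
    convert ha 2 using 1
    rw [hab]
    simp [rootMatrix, vecMul, dotProduct, Fin.sum_univ_three]
    ring
  have hm : ∀ {y : F}, y ∈ L → w * y ∈ L := coe_mul_mem w
  have e1 : 2 * b 1 ∈ L := by
    convert L.sub_mem (L.add_mem (L.add_mem h0 (hm h0)) (L.sub_mem (hm h1) h1)) (hm h2) using 1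
    linear_combination (b 1 - b 2) * hw
  have e2 : 2 * b 2 ∈ L := by
    convert L.add_mem (L.sub_mem (L.sub_mem (hm h0) h0) (L.add_mem (hm h1) h1)) h2 using 1
    linear_combination (b 1 + b 2) * hw
  have h1' : b 0 + b 1 + (1 - w) * b 2 ∈ L := by
    convert L.add_mem h1 (L.sub_mem e2 (hm e2)) using 1
    ring
  intro i
  rw [Fin.sum_univ_three]
  fin_cases i
  · refine ⟨h2, ?_⟩
    convert L.add_mem (L.sub_mem h0 (hm h1')) (L.add_mem e2 (hm e1)) using 1
    change b 0 + b 1 + b 2 - w * b 0 = _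
    linear_combination (-b 2) * hw
  · refine ⟨e1, ?_⟩
    convert h0 using 1
    change b 0 + b 1 + b 2 - w * b 1 = _
    ring
  · refine ⟨e2, ?_⟩
    convert h1' using 1
    change b 0 + b 1 + b 2 - w * b 2 = _
    ring

end RootMatrix

/-! ### Nefness of the lattice and non-nefness of its tensor square -/

section Nef

open Matrix

/-- The standard lattice `𝒪_K³`. -/
abbrev stdLattice (K : Type) [Field K] : Submodule (𝓞 K) (Fin 3 → K) :=
  Submodule.span (𝓞 K) (Set.range fun i : Fin 3 => (Pi.single i 1 : Fin 3 → K))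

variable {K : Type} [Field K]

lemma stdLattice_le_pi_one : stdLattice K ≤ Submodule.pi Set.univ fun _ => 1 := by
  rw [Submodule.span_le]
  rintro _ ⟨i, rfl⟩ j _
  refine Submodule.mem_one.2 ⟨if j = i then 1 else 0, ?_⟩
  split_ifs with h
  · subst h
    simp
  · simp [h]

lemma isNef_stdLattice [NumberField K] {ω : 𝓞 K} (hw : (ω : K) ^ 2 = ω - 2) {lam : ℝ}
    (hlam : lam ≤ Real.log 3 - (2 / 3) * Real.log 2) :
    IsNef K (fun σ => (Real.exp lam : ℂ) • !![2, σ (ω : K), 1; σ (1 - (ω : K)), 2, 1; 1, 1, 2])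
      (stdLattice K) := by
  intro F _ _ _ ψ hne
  set w : 𝓞 F := NumberField.RingOfIntegers.mapRingHom (algebraMap K F) ω
  have hwF : (w : F) = algebraMap K F ω := NumberField.RingOfIntegers.mapRingHom_apply _ ω
  have hw' : (w : F) ^ 2 = w - 2 := by
    rw [hwF, ← map_pow, hw, map_sub, map_ofNat]
  set a : Fin 3 → F := fun i => ψ (Pi.single i 1)
  set b := a ᵥ* rootMatrixInv (w : F) with hb
  have hab : a = b ᵥ* rootMatrix (w : F) := by
    rw [hb, vecMul_vecMul, mul_eq_one_comm.1 (rootMatrix_mul_rootMatrixInv hw'), vecMul_one]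
  have hspan := map_le_span_range (baseChange_le_pi_one (F := F) (stdLattice_le_pi_one (K := K))) ψ
  obtain ⟨d, hd, hdL⟩ := exists_denominator a
  have hb0 : b ≠ 0 := by
    intro h
    rw [h, zero_vecMul] at hab
    refine hne (eq_bot_iff.2 (hspan.trans (Submodule.span_le.2 ?_)))
    rintro _ ⟨i, rfl⟩
    exact (Submodule.mem_bot _).2 (congrFun hab i)
  have hroot : IsRootFrame ((baseChange K F (stdLattice K)).map (ψ.restrictScalars (𝓞 F))) w b :=
    isRootFrame_vecMul_rootMatrixInv hw' fun i =>
      apply_mem_map_baseChange ψ (Submodule.subset_span (R := 𝓞 K) (Set.mem_range_self i))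
  refine degLine_nonneg_of_isRootFrame hd (fun y hy => hdL y (hspan hy)) hw' hroot hb0 hlam
    fun σ => ?_
  have hs : (σ w) ^ 2 = σ w - 2 := by
    rw [← map_pow, hw', map_sub, map_ofNat]
  refine quotMetric_eq _ ψ σ (rootMatrix (σ w)) (rootMatrixInv (σ w))
    (rootMatrix_mul_rootMatrixInv hs) (by positivity) ?_ (fun k => σ (b k)) (fun i => ?_) ?_
  · rw [← smul_gram_eq hs, hwF, baseChangeMetric]
    simp
  · rw [← map_rootMatrix]
    exact (congrArg σ (congrFun hab i)).trans (RingHom.map_vecMul σ _ _ i)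
  · obtain ⟨i, hi⟩ := Function.ne_iff.1 hb0
    exact Finset.sum_pos' (fun k _ => Complex.normSq_nonneg _)
      ⟨i, Finset.mem_univ i, by simpa using hi⟩

/-- The coefficients on pure tensors of a linear form on the tensor square. -/
def destabilizingForm {R : Type} [CommRing R] (w : R) : Matrix (Fin 3) (Fin 3) R :=
  !![-1, 1 - w, 1; 1 - w, 2, 1; 1, 1, 2]

/-- The coordinates of `destabilizingForm w` in the tensor square of an orthogonal frame of
roots. -/
def destabilizingCoord {R : Type} [Field R] (w : R) : Matrix (Fin 3) (Fin 3) R :=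
  !![1 / 2, 0, 0; 0, (1 - w) / 4, (1 - w) / 4; 0, (1 - w) / 4, -(1 - w) / 4]

lemma destabilizingForm_eq {R : Type} [Field R] [CharZero R] {w : R} (hw : w ^ 2 = w - 2) :
    destabilizingForm w = (rootMatrix w)ᵀ * destabilizingCoord w * rootMatrix w := by
  have h3 : w ^ 3 = -w - 2 := by linear_combination (w + 1) * hw
  ext i j
  fin_cases i <;> fin_cases j <;>
    simp [destabilizingForm, destabilizingCoord, rootMatrix, Matrix.mul_apply,
      Fin.sum_univ_three] <;>
    ring_nf <;> (try simp only [hw, h3]) <;> ring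

lemma sum_normSq_destabilizingCoord {w : ℂ} (hw : w ^ 2 = w - 2) :
    ∑ p : Fin 3 × Fin 3, Complex.normSq (destabilizingCoord w p.1 p.2) = 3 / 4 := by
  obtain ⟨h1, h2⟩ := re_im_of_sq_eq hw
  have h : Complex.normSq (1 - w) = 2 := by
    rw [Complex.normSq_apply]
    simp only [Complex.sub_re, Complex.sub_im, Complex.one_re, Complex.one_im, h1]
    linarith
  have h' : Complex.normSq (w - 1) = 2 := by rw [← h, ← Complex.normSq_neg, neg_sub]
  rw [Fintype.sum_prod_type]
  simp [destabilizingCoord, Fin.sum_univ_three, h, h']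
  norm_num

lemma map_destabilizingForm {R R' : Type} [CommRing R] [CommRing R'] (σ : R →+* R') (w : R)
    (i j : Fin 3) : σ (destabilizingForm w i j) = destabilizingForm (σ w) i j := by
  have h2 : σ 2 = 2 := map_ofNat σ 2
  fin_cases i <;> fin_cases j <;> simp [destabilizingForm, h2]

lemma not_isNef_tensor_stdLattice [NumberField K] {ω : 𝓞 K} (hw : (ω : K) ^ 2 = ω - 2)
    {lam : ℝ} (hlam : Real.log 3 / 2 < lam) (H : (K →+* ℂ) → Matrix (Fin 3) (Fin 3) ℂ)
    (hH : H = fun σ => (Real.exp lam : ℂ) •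
      !![2, σ (ω : K), 1; σ (1 - (ω : K)), 2, 1; 1, 1, 2]) :
    ¬ IsNef K (fun σ => Matrix.of fun p q : Fin 3 × Fin 3 => H σ p.1 q.1 * H σ p.2 q.2)
      (Submodule.span (𝓞 K) { v : Fin 3 × Fin 3 → K |
        ∃ a ∈ stdLattice K, ∃ b ∈ stdLattice K, v = fun p => a p.1 * b p.2 }) := by
  intro hnef
  set T := Submodule.span (𝓞 K) { v : Fin 3 × Fin 3 → K |
    ∃ a ∈ stdLattice K, ∃ b ∈ stdLattice K, v = fun p => a p.1 * b p.2 } with hT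
  set ψ : (Fin 3 × Fin 3 → K) →ₗ[K] K :=
    ∑ p, destabilizingForm (ω : K) p.1 p.2 • LinearMap.proj p with hψ
  have hψs : ∀ p, ψ (Pi.single p 1) = destabilizingForm (ω : K) p.1 p.2 := fun p => by
    simp [hψ, Pi.single_apply]
  have hTpi : T ≤ Submodule.pi Set.univ fun _ => 1 := by
    rw [hT, Submodule.span_le]
    rintro _ ⟨a, ha, b, hb, rfl⟩ p _
    obtain ⟨s, hs⟩ := Submodule.mem_one.1 (stdLattice_le_pi_one ha p.1 trivial)
    obtain ⟨t, ht⟩ := Submodule.mem_one.1 (stdLattice_le_pi_one hb p.2 trivial)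
    exact Submodule.mem_one.2 ⟨s * t, (map_mul (algebraMap (𝓞 K) K) s t).trans (congrArg₂ (· * ·) hs ht)⟩
  set L := (baseChange K K T).map (ψ.restrictScalars (𝓞 K)) with hLdef
  have h1 : (1 : K) ∈ L := by
    have h02 : (Pi.single (0, 2) 1 : Fin 3 × Fin 3 → K) ∈ T := by
      refine Submodule.subset_span ⟨_, Submodule.subset_span ⟨0, rfl⟩, _,
        Submodule.subset_span ⟨2, rfl⟩, ?_⟩
      ext ⟨i, j⟩
      by_cases hi : i = 0 <;> by_cases hj : j = 2 <;> simp [hi, hj]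
    have h := apply_mem_map_baseChange (F := K) ψ h02
    rw [hψs] at h
    exact h
  have hL : ∀ y, y ∈ L ↔ ∃ z : 𝓞 K, (z : K) = y := by
    refine fun y => ⟨fun hy => ?_, ?_⟩
    · refine Submodule.mem_one.1 (Submodule.span_le.2 ?_
        (map_le_span_range (baseChange_le_pi_one (F := K) hTpi) ψ hy))
      rintro _ ⟨p, rfl⟩
      exact Submodule.mem_one.2 ⟨destabilizingForm ω p.1 p.2,
        (map_destabilizingForm (algebraMap (𝓞 K) K) ω p.1 p.2).trans (hψs p).symm⟩
    · rintro ⟨z, rfl⟩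
      simpa [Algebra.smul_def] using L.smul_mem z h1
  have hg : ∀ σ : K →+* ℂ, quotMetric (baseChangeMetric K K fun σ => Matrix.of
      fun p q : Fin 3 × Fin 3 => H σ p.1 q.1 * H σ p.2 q.2) ψ σ = Real.exp lam ^ 2 / 3 := by
    intro σ
    have hs : (σ ω) ^ 2 = σ ω - 2 := by
      rw [← map_pow, hw, map_sub, map_ofNat]
    have hHσ : H σ = ((Real.exp lam / 2 : ℝ) : ℂ) • ((rootMatrix (σ ω))ᴴ * rootMatrix (σ ω)) := by
      rw [← smul_gram_eq hs, hH]
      simp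
    have hN := sum_normSq_destabilizingCoord hs
    rw [quotMetric_eq (c := (Real.exp lam / 2) ^ 2) _ ψ σ
      (kroneckerMap (· * ·) (rootMatrix (σ ω)) (rootMatrix (σ ω)))
      (kroneckerMap (· * ·) (rootMatrixInv (σ ω)) (rootMatrixInv (σ ω))) ?_ (by positivity) ?_
      (fun p => destabilizingCoord (σ ω) p.1 p.2) (fun p => ?_) (by rw [hN]; norm_num), hN]
    · ring
    · rw [← mul_kronecker_mul, rootMatrix_mul_rootMatrixInv hs, one_kronecker_one]
    · rw [conjTranspose_kronecker, ← mul_kronecker_mul]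
      ext p q
      simp only [baseChangeMetric, Algebra.algebraMap_self, RingHom.comp_id, hHσ, of_apply,
        Matrix.smul_apply, kroneckerMap_apply, smul_eq_mul]
      push_cast
      ring
    · rw [hψs, map_destabilizingForm, destabilizingForm_eq hs]
      simp only [Matrix.mul_apply, vecMul, dotProduct, Fintype.sum_prod_type, transpose_apply,
        kroneckerMap_apply, Fin.sum_univ_three]
      ring
  have hpos : 0 < Real.log (Real.exp lam ^ 2 / 3) := by
    rw [Real.log_div (by positivity) (by norm_num), Real.log_pow, Real.log_exp]
    push_cast
    linarith
  have hdeg := hnef K ψ (fun h => by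
    rw [← hLdef] at h
    rw [h] at h1
    simp at h1)
  rw [degLine_ringOfIntegers hL (fun σ => by rw [hg]; positivity)] at hdeg
  have : 0 < ∑ σ : K →+* ℂ, Real.log (quotMetric (baseChangeMetric K K fun σ => Matrix.of
      fun p q : Fin 3 × Fin 3 => H σ p.1 q.1 * H σ p.2 q.2) ψ σ) / 2 :=
    Finset.sum_pos (fun σ _ => by rw [hg]; positivity) Finset.univ_nonempty
  exact (neg_neg_of_pos this).not_ge hdeg

end Nef

/-- Let `K = ℚ(√-7)`, `ω = (1+√-7)/2 ∈ 𝒪_K`, and let `Ē` be the hermitian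
`𝒪_K`-lattice that is free with basis `(e₁,e₂,e₃)` (here the standard lattice `𝒪_K³ ⊆ K³`)
and hermitian Gram matrix `[[2, ω, 1], [conj ω, 2, 1], [1, 1, 2]]` at the complex place of
`K` (at the embedding `σ`, the entries `ω`, `conj ω = 1 - ω` are read through `σ`).  Fix
`λ ∈ (½·log 3, log 3 - ⅔·log 2]`.  Then `Ē⟨-λ⟩` (norms multiplied by `e^{λ/[K:ℚ]}`,
i.e. Gram matrices multiplied by `e^{λ}`) is nef, but its tensor square `Ē⟨-λ⟩ ⊗ Ē⟨-λ⟩`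
(the `𝒪_K`-span of the pure tensors, with the tensor product metrics) is not nef.
In particular the tensor product of nef hermitian lattices need not be nef. -/
theorem nef_tensor_square_not_nef (K : Type) [Field K] [NumberField K]
    (θ : K) (hθ : θ ^ 2 = -7) (hdeg : Module.finrank ℚ K = 2)
    (ω : 𝓞 K) (hω : (ω : K) = (1 + θ) / 2)
    (lam : ℝ) (hlam : Real.log 3 / 2 < lam ∧ lam ≤ Real.log 3 - (2 / 3) * Real.log 2)
    (E : Submodule (𝓞 K) (Fin 3 → K))
    (hE : E = Submodule.span (𝓞 K) (Set.range fun i : Fin 3 => (Pi.single i 1 : Fin 3 → K)))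
    (H : (K →+* ℂ) → Matrix (Fin 3) (Fin 3) ℂ)
    (hH : H = fun σ => (Real.exp lam : ℂ) •
      !![2, σ (ω : K), 1; σ (1 - (ω : K)), 2, 1; 1, 1, 2]) :
    IsNef K H E ∧
      ¬ IsNef K (fun σ => Matrix.of fun p q : Fin 3 × Fin 3 => H σ p.1 q.1 * H σ p.2 q.2)
        (Submodule.span (𝓞 K) { v : Fin 3 × Fin 3 → K |
          ∃ a ∈ E, ∃ b ∈ E, v = fun p => a p.1 * b p.2 }) := by
  have hw : (ω : K) ^ 2 = ω - 2 := by
    rw [hω]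
    linear_combination hθ / 4
  subst hE
  exact ⟨hH ▸ isNef_stdLattice hw hlam.2, not_isNef_tensor_stdLattice hw hlam.1 H hH⟩
end
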